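/- Fix a real number α with 0 < α ≤ 1/2 and α ≠ (√5 - 1)/(2√5). There exists N such that for every even integer n ≥ N, the unique tree T* on n vertices maximizing Ψ(T,α) = αλ₁(T) + (1-α)λ₂(T) over all trees T on n vertices satisfies: T* ≅ DC((n-4)/2, (n-4)/2, 4) if α < (√5 - 1)/(2√5), and T* ≅ DC((n-4)/2, (n-2)/2, 3) if α > (√5 - 1)/(2√5). -/

import Mathlib

open scoped Classical

/-- Adjacency matrix of a simple graph on `Fin n`, over `ℝ`. -/
noncomputable def adjMat {n : ℕ} (G : SimpleGraph (Fin n)) : Matrix (Fin n) (Fin n) ℝ :=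
  fun i j => if G.Adj i j then 1 else 0

/-- The eigenvalues (roots of the characteristic polynomial, with multiplicity)
of the adjacency matrix, sorted in nondecreasing order. -/
noncomputable def eigList {n : ℕ} (G : SimpleGraph (Fin n)) : List ℝ :=
  (Matrix.charpoly (adjMat G)).roots.sort (· ≤ ·)

/-- `lam k G` is the `k`-th largest adjacency eigenvalue of `G` (so `lam 1` is `λ₁`). -/
noncomputable def lam {n : ℕ} (k : ℕ) (G : SimpleGraph (Fin n)) : ℝ :=
  (eigList G).getD (n - k) 0

/-- The double comet `DC(k1, k2, l)`: a path on `l` vertices (the vertices `0, …, l-1`),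
with `k1` pendant leaves attached to the terminal vertex `0` and `k2` pendant leaves
attached to the terminal vertex `l - 1`. -/
def doubleComet (k1 k2 l : ℕ) : SimpleGraph (Fin (k1 + k2 + l)) :=
  SimpleGraph.fromRel (fun i j =>
    ((i : ℕ) + 1 = (j : ℕ) ∧ (j : ℕ) < l) ∨
    (l ≤ (i : ℕ) ∧ (i : ℕ) < l + k1 ∧ (j : ℕ) = 0) ∨
    (l + k1 ≤ (i : ℕ) ∧ (j : ℕ) = l - 1))

/-- Degree of a vertex. -/
noncomputable def deg {n : ℕ} (G : SimpleGraph (Fin n)) (u : Fin n) : ℕ :=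
  (Finset.univ.filter (fun w => G.Adj u w)).card

section PartA
open Matrix

lemma adjMat_herm {n : ℕ} (G : SimpleGraph (Fin n)) : (adjMat G).IsHermitian := by
  ext i j
  simp [adjMat, Matrix.conjTranspose_apply, G.adj_comm]

/-- Spectral package. -/
lemma spec {n : ℕ} (G : SimpleGraph (Fin n)) :
    ∃ (μ : Fin n → ℝ) (v : Fin n → Fin n → ℝ), Antitone μ ∧
      (∀ i j, ∑ a, v i a * v j a = if i = j then 1 else 0) ∧
      (∀ i a, ∑ b, adjMat G a b * v i b = μ i * v i a) ∧
      (∀ i : Fin n, lam (i.val + 1) G = μ i) ∧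
      (adjMat G).charpoly.roots = Multiset.map μ Finset.univ.val ∧
      (adjMat G * adjMat G).trace = ∑ i, μ i ^ 2 := by
  have hA := adjMat_herm G
  have hc : Fintype.card (Fin n) = n := Fintype.card_fin n
  let e : Fin (Fintype.card (Fin n)) ≃ Fin n := Fintype.equivOfCardEq (Fintype.card_fin _)
  let c : Fin n ≃ Fin (Fintype.card (Fin n)) := finCongr hc.symm
  have hμe : ∀ i, hA.eigenvalues (e (c i)) = hA.eigenvalues₀ (c i) := by
    intro i; simp [Matrix.IsHermitian.eigenvalues, e]
  have hroots : (adjMat G).charpoly.roots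
      = Multiset.map (fun i => hA.eigenvalues₀ (c i)) Finset.univ.val := by
    rw [hA.roots_charpoly_eq_eigenvalues]
    have := Multiset.map_univ_val_equiv (c.trans e)
    conv_lhs => rw [← this, Multiset.map_map]
    refine Multiset.map_congr rfl ?_
    intro i _
    simpa using hμe i
  refine ⟨fun i => hA.eigenvalues₀ (c i), fun i => hA.eigenvectorBasis (e (c i)), ?_, ?_, ?_, ?_,
    hroots, ?_⟩
  · intro i j hij
    exact hA.eigenvalues₀_antitone (by simpa [c] using hij)
  · intro i j
    have := (orthonormal_iff_ite.1 hA.eigenvectorBasis.orthonormal) (e (c j)) (e (c i))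
    simp only [PiLp.inner_apply, RCLike.inner_apply, conj_trivial] at this
    rw [this]
    simp [eq_comm]
  · intro i a
    have := congrFun (hA.mulVec_eigenvectorBasis (e (c i))) a
    rw [hμe] at this
    simpa [Matrix.mulVec, dotProduct] using this
  · intro i
    have hs : eigList G = (List.ofFn (fun i => hA.eigenvalues₀ (c i))).reverse := by
      unfold eigList
      refine List.Perm.eq_of_pairwise' (r := (· ≤ ·)) (Multiset.pairwise_sort _ _) ?_ ?_
      · rw [List.pairwise_reverse, List.pairwise_ofFn]
        intro i j hij
        exact hA.eigenvalues₀_antitone (by simpa [c] using hij.le)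
      · rw [← Multiset.coe_eq_coe, Multiset.sort_eq, hroots, Multiset.coe_reverse,
          Fin.univ_val_map]
    unfold lam
    rw [hs, List.getD_eq_getElem _ _ (by
      rw [List.length_reverse, List.length_ofFn]; have := i.isLt; omega)]
    rw [List.getElem_reverse]
    simp only [List.getElem_ofFn, List.length_ofFn]
    congr 2
    ext
    simp
    omega
  · have h1 := hA.spectral_theorem
    have h2 : (adjMat G * adjMat G).trace = ∑ i, hA.eigenvalues i ^ 2 := by
      have hstar : star (hA.eigenvectorUnitary : Matrix (Fin n) (Fin n) ℝ) *
          (hA.eigenvectorUnitary : Matrix (Fin n) (Fin n) ℝ) = 1 :=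
        Unitary.coe_star_mul_self _
      set U := (hA.eigenvectorUnitary : Matrix (Fin n) (Fin n) ℝ) with hU
      set D : Matrix (Fin n) (Fin n) ℝ := diagonal (RCLike.ofReal ∘ hA.eigenvalues) with hD
      have h3 : adjMat G = U * D * star U := by
        rw [h1, Unitary.conjStarAlgAut_apply]
      have h4 : adjMat G * adjMat G = U * (D * D * star U) := by
        rw [h3]
        calc U * D * star U * (U * D * star U) = U * D * (star U * U) * D * star U := by
              simp only [Matrix.mul_assoc]
          _ = _ := by rw [hstar]; simp only [Matrix.mul_assoc, Matrix.one_mul, Matrix.mul_one]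
      rw [h4, Matrix.trace_mul_comm, Matrix.mul_assoc, hstar, hD]
      simp [Matrix.diagonal_mul_diagonal, Matrix.trace, sq]
    rw [h2, ← Equiv.sum_comp (c.trans e)]
    refine Finset.sum_congr rfl fun i _ => ?_
    rw [Equiv.trans_apply, hμe]

lemma charpoly_symm {n : ℕ} (G : SimpleGraph (Fin n)) (s : Fin n → ℝ) (hs : ∀ a, s a * s a = 1)
    (hadj : ∀ a b, G.Adj a b → s a * s b = -1) :
    (adjMat G).charpoly.roots.map (fun x => -x) = (adjMat G).charpoly.roots := by
  rw [← Polynomial.roots_comp_neg_X]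
  have hD : diagonal s * diagonal s = (1 : Matrix (Fin n) (Fin n) ℝ) := by
    rw [Matrix.diagonal_mul_diagonal]; simp [hs]
  have key : (adjMat G).charpoly.comp (-Polynomial.X)
      = Polynomial.C ((-1 : ℝ) ^ n) * (adjMat G).charpoly := by
    apply Polynomial.funext
    intro t
    rw [Polynomial.eval_comp, Polynomial.eval_mul, Polynomial.eval_C, Matrix.eval_charpoly,
      Matrix.eval_charpoly, Polynomial.eval_neg, Polynomial.eval_X]
    have h1 : scalar (Fin n) (-t) - adjMat G
        = - (diagonal s * (scalar (Fin n) t - adjMat G) * diagonal s) := by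
      ext a b
      rw [Matrix.neg_apply, Matrix.mul_diagonal, Matrix.diagonal_mul]
      simp only [Matrix.sub_apply, Matrix.scalar_apply, Matrix.diagonal_apply, adjMat]
      by_cases hab : a = b
      · subst hab
        simp
        linear_combination (-t) * hs a
      · simp only [hab, if_false]
        split_ifs with h
        · have := hadj a b h; nlinarith
        · simp
    rw [h1, Matrix.det_neg, Matrix.det_mul, Matrix.det_mul]
    have := congrArg Matrix.det hD
    rw [Matrix.det_mul, Matrix.det_one] at this
    rw [Fintype.card_fin]
    linear_combination (-1) ^ n * ((scalar (Fin n)) t - adjMat G).det * this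
  rw [key, Polynomial.roots_C_mul]
  exact pow_ne_zero _ (by norm_num)

lemma trace_sq {n : ℕ} (G : SimpleGraph (Fin n)) (hG : G.IsTree) :
    (adjMat G * adjMat G).trace = 2 * ((n : ℝ) - 1) := by
  have h1 := hG.card_edgeFinset
  have h2 := G.sum_degrees_eq_twice_card_edges
  rw [Fintype.card_fin] at h1
  have h3 : (adjMat G * adjMat G).trace = ∑ a, (G.degree a : ℝ) := by
    unfold Matrix.trace
    refine Finset.sum_congr rfl fun a _ => ?_
    rw [Matrix.diag_apply, Matrix.mul_apply, ← SimpleGraph.card_neighborFinset_eq_degree,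
      Finset.card_eq_sum_ones, Nat.cast_sum, SimpleGraph.neighborFinset_eq_filter,
      Finset.sum_filter]
    refine Finset.sum_congr rfl fun b _ => ?_
    by_cases h : G.Adj a b
    · simp [adjMat, h, h.symm]
    · simp [adjMat, h]
  rw [h3]
  have h4 : ((∑ a, G.degree a : ℕ) : ℝ) = ((2 * G.edgeFinset.card : ℕ) : ℝ) := by rw [h2]
  push_cast at h4
  rw [h4]
  have : ((G.edgeFinset.card : ℕ) : ℝ) + 1 = n := by exact_mod_cast h1
  linarith

lemma tree_sign {n : ℕ} (G : SimpleGraph (Fin n)) (hG : G.IsTree) :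
    ∃ c : Fin n → Prop, ∀ a b, G.Adj a b → (c a ↔ ¬ c b) := by
  obtain ⟨C⟩ := hG.colorable_two
  refine ⟨fun a => C a = 0, fun a b h => ?_⟩
  have h1 := C.valid h
  show C a = 0 ↔ ¬ C b = 0
  revert h1
  generalize C a = x
  generalize C b = y
  revert x y
  decide

/-- `λ₁² + λ₂² ≤ n - 1`. -/
lemma F1 {n : ℕ} (hn : 2 ≤ n) (G : SimpleGraph (Fin n)) (hG : G.IsTree) :
    (max (lam 1 G) 0) ^ 2 + (max (lam 2 G) 0) ^ 2 ≤ n - 1 := by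
  obtain ⟨μ, v, -, -, -, hlam, hroots, htr⟩ := spec G
  obtain ⟨c, hc⟩ := tree_sign G hG
  have hsym := charpoly_symm G (fun a => if c a then 1 else -1) (by intro a; split_ifs <;> simp)
    (by
      intro a b h
      have := hc a b h
      by_cases hb : c b <;> simp [hb] at this <;> simp [hb, this])
  rw [trace_sq G hG] at htr
  have h1 : ∑ i, (max (μ i) 0) ^ 2 = ∑ i, (max (-μ i) 0) ^ 2 := by
    have := congrArg (fun R => (Multiset.map (fun x : ℝ => (max x 0) ^ 2) R).sum) hsym
    simp only [hroots, Multiset.map_map] at this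
    exact this.symm
  have h2 : ∀ i, μ i ^ 2 = (max (μ i) 0) ^ 2 + (max (-μ i) 0) ^ 2 := by
    intro i
    rcases le_total (μ i) 0 with h | h
    · rw [max_eq_right h, max_eq_left (by linarith)]; ring
    · rw [max_eq_left h, max_eq_right (by linarith)]; ring
  have h3 : ∑ i, (max (μ i) 0) ^ 2 = n - 1 := by
    rw [Finset.sum_congr rfl (fun i _ => h2 i), Finset.sum_add_distrib] at htr
    linarith
  have l1 := hlam ⟨0, by omega⟩
  have l2 := hlam ⟨1, by omega⟩
  simp only [zero_add] at l1
  norm_num at l2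
  rw [l1, l2, ← h3]
  have := Finset.sum_le_sum_of_subset_of_nonneg
    (Finset.subset_univ ({⟨0, by omega⟩, ⟨1, by omega⟩} : Finset (Fin n)))
    (f := fun i => (max (μ i) 0) ^ 2) (fun i _ _ => by positivity)
  rwa [Finset.sum_pair (by simp)] at this

lemma lam_anti {n : ℕ} (hn : 2 ≤ n) (G : SimpleGraph (Fin n)) : lam 2 G ≤ lam 1 G := by
  obtain ⟨μ, v, hanti, -, -, hlam, hroots, htr⟩ := spec G
  have l1 := hlam ⟨0, by omega⟩
  have l2 := hlam ⟨1, by omega⟩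
  simp only [zero_add] at l1
  norm_num at l2
  rw [l1, l2]
  exact hanti (by simp)

/-- two distinct eigenvalues bound `lam 1, lam 2` from below -/
lemma lam_lower {n : ℕ} (hn : 2 ≤ n) (G : SimpleGraph (Fin n)) (m1 m2 : ℝ) (hm : m2 < m1)
    (x y : Fin n → ℝ) (hx0 : x ≠ 0) (hy0 : y ≠ 0)
    (hx : ∀ a, ∑ b, adjMat G a b * x b = m1 * x a)
    (hy : ∀ a, ∑ b, adjMat G a b * y b = m2 * y a) :
    m1 ≤ lam 1 G ∧ m2 ≤ lam 2 G := by
  obtain ⟨μ, v, hanti, -, -, hlam, hroots, -⟩ := spec G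
  have mem : ∀ (m : ℝ) (x : Fin n → ℝ), x ≠ 0 → (∀ a, ∑ b, adjMat G a b * x b = m * x a) →
      ∃ i, μ i = m := by
    intro m x hx0 hx
    have h1 : m ∈ (adjMat G).charpoly.roots := by
      rw [Polynomial.mem_roots (Matrix.charpoly_monic _).ne_zero, Polynomial.IsRoot,
        Matrix.eval_charpoly]
      apply Matrix.exists_mulVec_eq_zero_iff.1
      refine ⟨x, hx0, ?_⟩
      ext a
      have h2 := hx a
      rw [Matrix.sub_mulVec, Pi.sub_apply]
      simp only [Matrix.scalar_apply, Matrix.mulVec_diagonal, Pi.zero_apply]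
      simp only [Matrix.mulVec, dotProduct]
      linarith
    rw [hroots] at h1
    obtain ⟨i, -, hi⟩ := Multiset.mem_map.1 h1
    exact ⟨i, hi⟩
  obtain ⟨i, hi⟩ := mem m1 x hx0 hx
  obtain ⟨j, hj⟩ := mem m2 y hy0 hy
  have l1 := hlam ⟨0, by omega⟩
  have l2 := hlam ⟨1, by omega⟩
  simp only [zero_add] at l1
  norm_num at l2
  rw [l1, l2, ← hi, ← hj]
  constructor
  · exact hanti (by simp [Fin.le_def])
  · apply hanti
    have : i < j := by
      by_contra hcon
      have := hanti (not_lt.1 hcon)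
      linarith
    rw [Fin.le_def]
    rw [Fin.lt_def] at this
    simp; omega

/-- eigenvectors for `lam 1`, `lam 2` -/
lemma lam_vec {n : ℕ} (hn : 2 ≤ n) (G : SimpleGraph (Fin n)) :
    ∃ x y : Fin n → ℝ, (∑ a, x a * x a = 1) ∧ (∑ a, y a * y a = 1) ∧ (∑ a, x a * y a = 0) ∧
      (∀ a, ∑ b, adjMat G a b * x b = lam 1 G * x a) ∧
      (∀ a, ∑ b, adjMat G a b * y b = lam 2 G * y a) := by
  obtain ⟨μ, v, hanti, hon, heig, hlam, -, -⟩ := spec G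
  have l1 := hlam ⟨0, by omega⟩
  have l2 := hlam ⟨1, by omega⟩
  simp only [zero_add] at l1
  norm_num at l2
  refine ⟨v ⟨0, by omega⟩, v ⟨1, by omega⟩, ?_, ?_, ?_, ?_, ?_⟩
  · rw [hon]; simp
  · rw [hon]; simp
  · rw [hon]; simp
  · intro a; rw [heig, l1]
  · intro a; rw [heig, l2]

end PartA

section PartB

/-- number of ordered pairs of intersecting edges -/
noncomputable def interN {V : Type*} (E : Finset (V × V)) : ℕ :=
  ((E ×ˢ E).filter (fun p => p.1.1 = p.2.1 ∨ p.1.2 = p.2.2)).card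

lemma interN_le {V : Type*} (E : Finset (V × V)) : interN E ≤ E.card ^ 2 := by
  unfold interN
  refine (Finset.card_filter_le _ _).trans ?_
  rw [Finset.card_product, sq]

lemma interN_nonstar {V : Type*} (E : Finset (V × V)) (hne : E.Nonempty)
    (h1 : ¬ ∃ u, ∀ f ∈ E, f.1 = u) (h2 : ¬ ∃ w, ∀ f ∈ E, f.2 = w) :
    interN E + 2 * E.card ≤ E.card ^ 2 + 6 := by
  -- two disjoint edges
  have hd : ∃ f ∈ E, ∃ g ∈ E, f.1 ≠ g.1 ∧ f.2 ≠ g.2 := by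
    obtain ⟨f, hf⟩ := hne
    push Not at h1 h2
    obtain ⟨g, hg, hg1⟩ := h1 f.1
    obtain ⟨h, hh, hh1⟩ := h2 f.2
    by_cases hg2 : g.2 = f.2
    · by_cases hh2 : h.1 = f.1
      · exact ⟨h, hh, g, hg, by rw [hh2]; exact hg1.symm, by rw [hg2]; exact hh1⟩
      · exact ⟨h, hh, f, hf, hh2, hh1⟩
    · exact ⟨g, hg, f, hf, hg1, hg2⟩
  obtain ⟨f, hf, g, hg, hfg1, hfg2⟩ := hd
  have hsplit := Finset.card_filter_add_card_filter_not (s := E ×ˢ E)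
    (fun p : (V × V) × (V × V) => p.1.1 = p.2.1 ∨ p.1.2 = p.2.2)
  rw [Finset.card_product] at hsplit
  set D := (E ×ˢ E).filter
    (fun p : (V × V) × (V × V) => ¬ (p.1.1 = p.2.1 ∨ p.1.2 = p.2.2)) with hD
  have hfgne : f ≠ g := fun h => hfg1 (by rw [h])
  let E' := E \ {f, g, (f.1, g.2), (g.1, f.2)}
  have hE' : E.card ≤ E'.card + 4 := by
    have h4 : ({f, g, (f.1, g.2), (g.1, f.2)} : Finset (V × V)).card ≤ 4 :=
      Finset.card_le_four
    have := Finset.le_card_sdiff ({f, g, (f.1, g.2), (g.1, f.2)} : Finset (V × V)) E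
    show E.card ≤ (E \ {f, g, (f.1, g.2), (g.1, f.2)}).card + 4
    omega
  let t : V × V → V × V := fun h => if h.1 = f.1 ∨ h.2 = f.2 then g else f
  have htd : ∀ h ∈ E', h ∈ E ∧ h ≠ f ∧ h ≠ g ∧ t h ∈ E ∧ h.1 ≠ (t h).1 ∧ h.2 ≠ (t h).2 ∧
      (t h = f ∨ t h = g) := by
    intro h hh
    simp only [E', Finset.mem_sdiff, Finset.mem_insert, Finset.mem_singleton, not_or] at hh
    obtain ⟨hhE, hhf, hhg, hh3, hh4⟩ := hh
    refine ⟨hhE, hhf, hhg, ?_⟩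
    by_cases hc : h.1 = f.1 ∨ h.2 = f.2
    · have : t h = g := if_pos hc
      rw [this]
      refine ⟨hg, ?_, ?_, Or.inr rfl⟩
      · intro h5
        rcases hc with hc | hc
        · exact hfg1 (hc.symm.trans h5)
        · exact hh4 (Prod.ext h5 hc)
      · intro h5
        rcases hc with hc | hc
        · exact hh3 (Prod.ext hc h5)
        · exact hfg2 (hc.symm.trans h5)
    · have : t h = f := if_neg hc
      rw [this]
      push Not at hc
      exact ⟨hf, hc.1, hc.2, Or.inl rfl⟩
  have hsub : E'.image (fun h => (h, t h)) ∪ E'.image (fun h => (t h, h)) ∪ {(f, g), (g, f)} ⊆ D := by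
    intro p hp
    simp only [Finset.mem_union, Finset.mem_image, Finset.mem_insert, Finset.mem_singleton] at hp
    simp only [hD, Finset.mem_filter, Finset.mem_product, not_or]
    rcases hp with (⟨h, hh, rfl⟩ | ⟨h, hh, rfl⟩) | rfl | rfl
    · obtain ⟨a1, a2, a3, a4, a5, a6, a7⟩ := htd h hh
      exact ⟨⟨a1, a4⟩, a5, a6⟩
    · obtain ⟨a1, a2, a3, a4, a5, a6, a7⟩ := htd h hh
      exact ⟨⟨a4, a1⟩, a5.symm, a6.symm⟩
    · exact ⟨⟨hf, hg⟩, hfg1, hfg2⟩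
    · exact ⟨⟨hg, hf⟩, hfg1.symm, hfg2.symm⟩
  have hcard := Finset.card_le_card hsub
  rw [Finset.card_union_of_disjoint, Finset.card_union_of_disjoint, Finset.card_image_of_injective,
    Finset.card_image_of_injective, Finset.card_pair] at hcard
  · unfold interN
    rw [sq]
    omega
  · intro h
    exact hfgne (congrArg Prod.fst h)
  · intro a b hab; exact congrArg Prod.snd hab
  · intro a b hab; exact congrArg Prod.fst hab
  · rw [Finset.disjoint_left]
    intro p hp hp'
    simp only [Finset.mem_image] at hp hp'
    obtain ⟨a, ha, rfl⟩ := hp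
    obtain ⟨b, hb, hab⟩ := hp'
    obtain ⟨a1, a2, a3, a4, a5, a6, a7⟩ := htd a ha
    obtain ⟨b1, b2, b3, b4, b5, b6, b7⟩ := htd b hb
    have := congrArg Prod.fst hab
    simp only at this
    rw [this] at b7
    tauto
  · rw [Finset.disjoint_left]
    intro p hp hp'
    simp only [Finset.mem_union, Finset.mem_image, Finset.mem_insert, Finset.mem_singleton] at hp hp'
    rcases hp with ⟨h, hh, rfl⟩ | ⟨h, hh, rfl⟩
    · obtain ⟨a1, a2, a3, a4, a5, a6, a7⟩ := htd h hh
      rcases hp' with h' | h'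
      · exact a2 (congrArg Prod.fst h')
      · exact a3 (congrArg Prod.fst h')
    · obtain ⟨a1, a2, a3, a4, a5, a6, a7⟩ := htd h hh
      rcases hp' with hx | hx
      · exact a3 (congrArg Prod.snd hx)
      · exact a2 (congrArg Prod.snd hx)

/-- the edges inside `C`, oriented by the colouring `c` -/
noncomputable def inE {n : ℕ} (G : SimpleGraph (Fin n)) (c : Fin n → Prop) (C : Set (Fin n)) :
    Finset (Fin n × Fin n) :=
  Finset.univ.filter (fun p => G.Adj p.1 p.2 ∧ c p.1 ∧ ¬ c p.2 ∧ p.1 ∈ C ∧ p.2 ∈ C)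

lemma mem_inE {n : ℕ} {G : SimpleGraph (Fin n)} {c : Fin n → Prop} {C : Set (Fin n)}
    {p : Fin n × Fin n} :
    p ∈ inE G c C ↔ G.Adj p.1 p.2 ∧ c p.1 ∧ ¬ c p.2 ∧ p.1 ∈ C ∧ p.2 ∈ C := by
  simp [inE]

lemma quad {n : ℕ} (G : SimpleGraph (Fin n)) (c : Fin n → Prop)
    (hc : ∀ a b, G.Adj a b → (c a ↔ ¬ c b))
    (h4 : ∀ a a' b b', G.Adj a b → G.Adj a b' → G.Adj a' b → G.Adj a' b' → a = a' ∨ b = b')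
    (C : Set (Fin n)) (z : Fin n → ℝ) (hz : ∀ a, z a ≠ 0 → a ∈ C) :
    (∑ a, ∑ b, adjMat G a b * (z a * z b)) ^ 4
      ≤ (∑ a, z a ^ 2) ^ 4 * (interN (inE G c C) : ℝ) := by
  set E := inE G c C with hE
  set B : Fin n → Fin n → ℝ := fun a b => if (a, b) ∈ E then 1 else 0 with hB
  set zP : Fin n → ℝ := fun a => if c a then z a else 0 with hzP
  set zQ : Fin n → ℝ := fun a => if c a then 0 else z a with hzQ
  set S : ℝ := ∑ a, zP a * ∑ b, B a b * zQ b with hS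
  have hS' : S = ∑ a, ∑ b, B a b * (z a * z b) := by
    rw [hS]
    refine Finset.sum_congr rfl fun a _ => ?_
    rw [Finset.mul_sum]
    refine Finset.sum_congr rfl fun b _ => ?_
    simp only [hB, hzP, hzQ]
    by_cases h : (a, b) ∈ E
    · have := mem_inE.1 h
      simp [h, this.2.1, this.2.2.1]
    · simp [h]
  have hq : (∑ a, ∑ b, adjMat G a b * (z a * z b)) = 2 * S := by
    have e1 : ∀ a b, adjMat G a b * (z a * z b) = B a b * (z a * z b) + B b a * (z b * z a) := by
      intro a b
      by_cases ha : z a = 0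
      · simp [ha]
      by_cases hb : z b = 0
      · simp [hb]
      have ha' := hz a ha
      have hb' := hz b hb
      simp only [hB, hE, mem_inE, adjMat]
      by_cases hab : G.Adj a b
      · have := hc a b hab
        by_cases hcb : c b
        · have hca : ¬ c a := fun h => (this.1 h) hcb
          simp [hab, hab.symm, hcb, hca, ha', hb', mul_comm]
        · have hca : c a := this.2 hcb
          simp [hab, hab.symm, hcb, hca, ha', hb', mul_comm]
      · have hba : ¬ G.Adj b a := fun h => hab h.symm
        simp [hab, hba]
    simp_rw [e1, Finset.sum_add_distrib]
    rw [Finset.sum_comm (f := fun a b => B b a * (z b * z a)), ← hS']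
    ring
  set P := ∑ a, zP a ^ 2 with hP
  set Q := ∑ a, zQ a ^ 2 with hQ
  have hP0 : 0 ≤ P := Finset.sum_nonneg fun a _ => sq_nonneg _
  have hQ0 : 0 ≤ Q := Finset.sum_nonneg fun a _ => sq_nonneg _
  have hPQ : ∑ a, z a ^ 2 = P + Q := by
    rw [hP, hQ, ← Finset.sum_add_distrib]
    refine Finset.sum_congr rfl fun a _ => ?_
    by_cases h : c a <;> simp [hzP, hzQ, h]
  set R : Fin n → ℝ := fun a => ∑ b, B a b * zQ b with hR
  have cs1 : S ^ 2 ≤ P * ∑ a, R a ^ 2 := Finset.sum_mul_sq_le_sq_mul_sq _ _ _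
  set g : Fin n × Fin n → ℝ := fun p => ∑ a, B a p.1 * B a p.2 with hg
  have hR2 : ∑ a, R a ^ 2 = ∑ p : Fin n × Fin n, g p * (zQ p.1 * zQ p.2) := by
    simp only [hR, hg]
    rw [Fintype.sum_prod_type]
    simp_rw [sq, Finset.sum_mul_sum, Finset.sum_mul]
    rw [Finset.sum_comm]
    refine Finset.sum_congr rfl fun b _ => ?_
    rw [Finset.sum_comm]
    refine Finset.sum_congr rfl fun b' _ => ?_
    refine Finset.sum_congr rfl fun a _ => ?_
    ring
  have cs2 : (∑ a, R a ^ 2) ^ 2 ≤ (∑ p, g p ^ 2) * Q ^ 2 := by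
    rw [hR2]
    refine (Finset.sum_mul_sq_le_sq_mul_sq _ _ _).trans (le_of_eq ?_)
    congr 1
    rw [Fintype.sum_prod_type, hQ, sq, Finset.sum_mul_sum]
    simp_rw [mul_pow]
  have hI : ∑ p, g p ^ 2 ≤ (interN E : ℝ) := by
    unfold interN
    rw [Finset.card_filter]
    push_cast
    rw [Finset.sum_product]
    have e2 : ∀ F : (Fin n × Fin n) → ℝ, ∑ x ∈ E, F x = ∑ a, ∑ b, B a b * F (a, b) := by
      intro F
      rw [← Fintype.sum_prod_type (f := fun p : Fin n × Fin n => B p.1 p.2 * F (p.1, p.2))]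
      simp only [hB]
      simp
    rw [e2]
    simp_rw [e2]
    rw [Fintype.sum_prod_type]
    simp only [hg]
    simp_rw [sq, Finset.sum_mul_sum, Finset.mul_sum]
    -- reindex the sums
    have e3 : ∑ b, ∑ b', ∑ a, ∑ a', B a b * B a b' * (B a' b * B a' b')
        = ∑ a, ∑ b, ∑ a', ∑ b', B a b * B a b' * (B a' b * B a' b') := by
      have : ∀ b, ∑ b', ∑ a, ∑ a', B a b * B a b' * (B a' b * B a' b')
          = ∑ a, ∑ a', ∑ b', B a b * B a b' * (B a' b * B a' b') := by
        intro b
        rw [Finset.sum_comm]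
        refine Finset.sum_congr rfl fun a _ => ?_
        rw [Finset.sum_comm]
      simp_rw [this]
      rw [Finset.sum_comm]
    rw [e3]
    refine Finset.sum_le_sum fun a _ => Finset.sum_le_sum fun b _ => Finset.sum_le_sum fun a' _ =>
      Finset.sum_le_sum fun b' _ => ?_
    simp only [hB]
    by_cases m1 : (a, b) ∈ E
    · by_cases m2 : (a, b') ∈ E
      · by_cases m3 : (a', b) ∈ E
        · by_cases m4 : (a', b') ∈ E
          · have := h4 a a' b b' (mem_inE.1 m1).1 (mem_inE.1 m2).1 (mem_inE.1 m3).1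
              (mem_inE.1 m4).1
            simp [m1, m2, m3, m4, this]
          · simp [m1, m2, m3, m4]
        · simp only [m3, if_false, zero_mul, mul_zero]
          positivity
      · simp only [m2, if_false, zero_mul, mul_zero]
        positivity
    · simp [m1]
  have hI0 : (0 : ℝ) ≤ interN E := Nat.cast_nonneg _
  have hS4 : S ^ 4 ≤ P ^ 2 * (Q ^ 2 * interN E) := by
    have hR0 : 0 ≤ ∑ a, R a ^ 2 := Finset.sum_nonneg fun a _ => sq_nonneg _
    calc S ^ 4 = (S ^ 2) ^ 2 := by ring
      _ ≤ (P * ∑ a, R a ^ 2) ^ 2 := by gcongr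
      _ = P ^ 2 * (∑ a, R a ^ 2) ^ 2 := by ring
      _ ≤ P ^ 2 * ((∑ p, g p ^ 2) * Q ^ 2) := by gcongr
      _ ≤ P ^ 2 * (interN E * Q ^ 2) := by gcongr
      _ = _ := by ring
  rw [hq, hPQ]
  have hpq : 16 * (P ^ 2 * Q ^ 2) ≤ (P + Q) ^ 4 := by
    have h5 : 4 * (P * Q) ≤ (P + Q) ^ 2 := by nlinarith [sq_nonneg (P - Q)]
    have h6 : 0 ≤ 4 * (P * Q) := by positivity
    calc 16 * (P ^ 2 * Q ^ 2) = (4 * (P * Q)) ^ 2 := by ring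
      _ ≤ ((P + Q) ^ 2) ^ 2 := by gcongr
      _ = _ := by ring
  calc (2 * S) ^ 4 = 16 * S ^ 4 := by ring
    _ ≤ 16 * (P ^ 2 * (Q ^ 2 * interN E)) := by gcongr
    _ = 16 * (P ^ 2 * Q ^ 2) * interN E := by ring
    _ ≤ _ := by gcongr

lemma no_four {n : ℕ} (G : SimpleGraph (Fin n)) (hG : G.IsTree) :
    ∀ a a' b b', G.Adj a b → G.Adj a b' → G.Adj a' b → G.Adj a' b' → a = a' ∨ b = b' := by
  intro a a' b b' h1 h2 h3 h4
  by_contra hcon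
  push Not at hcon
  have e := hG.isAcyclic.path_unique
    (⟨.cons h1 (.cons h3.symm .nil), by
      simp [SimpleGraph.Walk.isPath_def, h1.ne, h3.ne.symm, hcon.1]⟩ : G.Path a a')
    (⟨.cons h2 (.cons h4.symm .nil), by
      simp [SimpleGraph.Walk.isPath_def, h2.ne, h4.ne.symm, hcon.1]⟩ : G.Path a a')
  have := congrArg (fun p : G.Path a a' => p.1.support) e
  simp at this
  exact hcon.2 this

end PartB

section PartC

lemma quad_smul {n : ℕ} (G : SimpleGraph (Fin n)) (m : ℝ) (x y : Fin n → ℝ)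
    (hx : ∀ a, ∑ b, adjMat G a b * x b = m * x a) :
    ∑ a, ∑ b, adjMat G a b * (y a * x b) = m * ∑ a, y a * x a := by
  rw [Finset.mul_sum]
  refine Finset.sum_congr rfl fun a _ => ?_
  calc ∑ b, adjMat G a b * (y a * x b) = y a * ∑ b, adjMat G a b * x b := by
        rw [Finset.mul_sum]; exact Finset.sum_congr rfl fun b _ => by ring
    _ = _ := by rw [hx]; ring

/-- a vector vanishing at `v` with Rayleigh quotient at least `lam 2` -/
lemma vanish {n : ℕ} (hn : 2 ≤ n) (G : SimpleGraph (Fin n)) (v : Fin n) :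
    ∃ z : Fin n → ℝ, z v = 0 ∧ 0 < ∑ a, z a ^ 2 ∧
      lam 2 G * ∑ a, z a ^ 2 ≤ ∑ a, ∑ b, adjMat G a b * (z a * z b) := by
  obtain ⟨x, y, hxx, hyy, hxy, hx, hy⟩ := lam_vec hn G
  have hanti := lam_anti hn G
  obtain ⟨p, q, hpq, hv⟩ : ∃ p q : ℝ, 0 < p ^ 2 + q ^ 2 ∧ p * x v + q * y v = 0 := by
    by_cases h : x v = 0
    · exact ⟨1, 0, by norm_num, by simp [h]⟩
    · exact ⟨y v, - x v, by
        have h1 := sq_nonneg (y v)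
        have h2 : 0 < x v ^ 2 := by positivity
        nlinarith, by ring⟩
  have hn2 : ∑ a, (p * x a + q * y a) ^ 2 = p ^ 2 + q ^ 2 := by
    have : ∀ a, (p * x a + q * y a) ^ 2
        = p ^ 2 * (x a * x a) + q ^ 2 * (y a * y a) + 2 * p * q * (x a * y a) := by
      intro a; ring
    simp_rw [this, Finset.sum_add_distrib, ← Finset.mul_sum, hxx, hyy, hxy]
    ring
  refine ⟨fun a => p * x a + q * y a, hv, ?_, ?_⟩
  · rw [hn2]; exact hpq
  · have hyx : ∑ a, y a * x a = 0 := by rw [← hxy]; exact Finset.sum_congr rfl fun a _ => by ring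
    have : ∑ a, ∑ b, adjMat G a b * ((p * x a + q * y a) * (p * x b + q * y b))
        = lam 1 G * p ^ 2 + lam 2 G * q ^ 2 := by
      have e : ∀ a b, adjMat G a b * ((p * x a + q * y a) * (p * x b + q * y b))
        = p ^ 2 * (adjMat G a b * (x a * x b)) + q ^ 2 * (adjMat G a b * (y a * y b))
          + p * q * (adjMat G a b * (x a * y b)) + p * q * (adjMat G a b * (y a * x b)) := by
        intro a b; ring
      simp_rw [e, Finset.sum_add_distrib, ← Finset.mul_sum]
      rw [quad_smul G _ x x hx, quad_smul G _ y y hy, quad_smul G _ y x hy, quad_smul G _ x y hx,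
        hxx, hyy, hxy, hyx]
      ring
    rw [this, hn2]
    nlinarith [mul_le_mul_of_nonneg_right hanti (sq_nonneg p)]

lemma branch {n : ℕ} (hn : 2 ≤ n) (G : SimpleGraph (Fin n)) (hG : G.IsTree) (c : Fin n → Prop)
    (hc : ∀ a b, G.Adj a b → (c a ↔ ¬ c b)) (hl : 0 < lam 2 G) (v : Fin n) :
    ∃ w, G.Adj v w ∧
      lam 2 G ^ 4 ≤ (interN (inE G c {u | (G.deleteIncidenceSet v).Reachable w u}) : ℝ) := by
  obtain ⟨z, hzv, hz0, hz⟩ := vanish hn G v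
  set H := G.deleteIncidenceSet v with hH
  set N : H.ConnectedComponent → ℝ := fun κ =>
    ∑ a with H.connectedComponentMk a = κ, z a ^ 2 with hN
  set q : H.ConnectedComponent → ℝ := fun κ =>
    ∑ a with H.connectedComponentMk a = κ, ∑ b, adjMat G a b * (z a * z b) with hq
  have hNs : ∑ κ, N κ = ∑ a, z a ^ 2 :=
    Finset.sum_fiberwise _ _ _
  have hqs : ∑ κ, q κ = ∑ a, ∑ b, adjMat G a b * (z a * z b) :=
    Finset.sum_fiberwise _ _ _
  have hNn : ∀ κ, 0 ≤ N κ := fun κ => Finset.sum_nonneg fun a _ => sq_nonneg _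
  have hex : ∃ κ, 0 < N κ ∧ lam 2 G * N κ ≤ q κ := by
    by_contra hcon
    push Not at hcon
    have hle : ∀ κ, q κ ≤ lam 2 G * N κ := by
      intro κ
      rcases (hNn κ).eq_or_lt with h | h
      · have hz' : ∀ a ∈ Finset.univ.filter (fun a => H.connectedComponentMk a = κ),
            z a ^ 2 = 0 := (Finset.sum_eq_zero_iff_of_nonneg (fun a _ => sq_nonneg _)).1 h.symm
        have : q κ = 0 := by
          refine Finset.sum_eq_zero fun a ha => ?_
          have := hz' a ha
          have : z a = 0 := by simpa using this
          simp [this]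
        rw [this, ← h]; simp
      · exact (hcon κ h).le
    obtain ⟨κ, -, hκ⟩ : ∃ κ ∈ Finset.univ, 0 < N κ := by
      by_contra h0
      push Not at h0
      have := Finset.sum_nonpos h0
      rw [hNs] at this
      linarith
    have := Finset.sum_lt_sum (fun κ _ => hle κ) ⟨κ, Finset.mem_univ _, hcon κ hκ⟩
    rw [hqs, ← Finset.mul_sum, hNs] at this
    linarith
  obtain ⟨κ, hκ, hκq⟩ := hex
  -- a vertex in the component
  obtain ⟨u, hu, huz⟩ : ∃ u, H.connectedComponentMk u = κ ∧ z u ≠ 0 := by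
    by_contra h0
    push Not at h0
    have : N κ = 0 := Finset.sum_eq_zero fun a ha => by
      rw [h0 a (by simpa using ha)]; simp
    linarith
  have huv : u ≠ v := fun h => huz (h ▸ hzv)
  -- a neighbour of v in the component
  have hw : ∀ (s t : Fin n) (p : G.Walk s t), t = v → s ≠ v → ∃ w, G.Adj v w ∧ H.Reachable s w := by
    intro s t p
    induction p with
    | nil => intro h1 h2; exact absurd h1 h2
    | cons hadj p ih =>
      rename_i s s' t
      intro h1 h2
      by_cases h3 : s' = v
      · exact ⟨s, by rw [← h3]; exact hadj.symm, SimpleGraph.Reachable.refl _⟩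
      · obtain ⟨w, hw1, hw2⟩ := ih h1 h3
        refine ⟨w, hw1, SimpleGraph.Reachable.trans (SimpleGraph.Adj.reachable ?_) hw2⟩
        rw [hH, SimpleGraph.deleteIncidenceSet_adj]
        exact ⟨hadj, h2, h3⟩
  obtain ⟨p⟩ := hG.connected.preconnected u v
  obtain ⟨w, hvw, hrw⟩ := hw u v p rfl huv
  refine ⟨w, hvw, ?_⟩
  have hmem : ∀ a, H.connectedComponentMk a = κ ↔ a ∈ {u | H.Reachable w u} := by
    intro a
    rw [← hu, SimpleGraph.ConnectedComponent.eq, Set.mem_setOf_eq]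
    constructor
    · intro h; exact (h.trans hrw).symm
    · intro h; exact (hrw.trans h).symm
  set y : Fin n → ℝ := fun a => if H.connectedComponentMk a = κ then z a else 0 with hy
  have hQ := quad G c hc (no_four G hG) {u | H.Reachable w u} y (by
    intro a ha
    rw [← hmem]
    by_contra h
    exact ha (by simp [hy, h]))
  have hyN : ∑ a, y a ^ 2 = N κ := by
    simp only [hN, Finset.sum_filter]
    refine Finset.sum_congr rfl fun a _ => ?_
    by_cases h : H.connectedComponentMk a = κ <;> simp [hy, h]
  have hyq : ∑ a, ∑ b, adjMat G a b * (y a * y b) = q κ := by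
    simp only [hq, Finset.sum_filter]
    refine Finset.sum_congr rfl fun a _ => ?_
    by_cases h : H.connectedComponentMk a = κ
    · rw [if_pos h]
      refine Finset.sum_congr rfl fun b _ => ?_
      by_cases h' : H.connectedComponentMk b = κ
      · simp [hy, h, h']
      · simp only [hy, h, h', if_true, if_false, mul_zero]
        by_cases hab : G.Adj a b
        · by_cases ha : a = v
          · simp [ha, hzv]
          by_cases hb : b = v
          · simp [hb, hzv]
          exfalso
          apply h'
          rw [← h, SimpleGraph.ConnectedComponent.eq]
          apply SimpleGraph.Adj.reachable
          rw [hH, SimpleGraph.deleteIncidenceSet_adj]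
          exact ⟨hab.symm, hb, ha⟩
        · simp [adjMat, hab]
    · simp [hy, h]
  rw [hyN, hyq] at hQ
  have h5 : (lam 2 G * N κ) ^ 4 ≤ N κ ^ 4 * interN (inE G c {u | H.Reachable w u}) :=
    le_trans (by gcongr) hQ
  have h6 : 0 < N κ ^ 4 := by positivity
  rw [mul_pow, mul_comm] at h5
  exact le_of_mul_le_mul_left h5 h6

lemma star_of {n : ℕ} (G : SimpleGraph (Fin n)) (c : Fin n → Prop)
    (hc : ∀ a b, G.Adj a b → (c a ↔ ¬ c b)) (C : Set (Fin n)) (k : ℕ) (hk : 8 ≤ k)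
    (hcard : (inE G c C).card = k + 1)
    (hI : ((k : ℝ) + 3 / 8) ^ 2 ≤ (interN (inE G c C) : ℝ)) :
    ∃ (h : Fin n) (L : Finset (Fin n)), h ∈ C ∧ h ∉ L ∧ (∀ b ∈ L, b ∈ C) ∧ k + 1 ≤ L.card ∧
      ∀ a b, a ∈ C → b ∈ C → (G.Adj a b ↔ (a = h ∧ b ∈ L) ∨ (b = h ∧ a ∈ L)) := by
  have hne : (inE G c C).Nonempty := by rw [← Finset.card_pos]; omega
  have horient : ∀ a b, a ∈ C → b ∈ C → G.Adj a b → (a, b) ∈ inE G c C ∨ (b, a) ∈ inE G c C := by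
    intro a b ha hb hab
    have := hc a b hab
    by_cases h : c b
    · exact Or.inr (mem_inE.2 ⟨hab.symm, h, fun h' => this.1 h' h, hb, ha⟩)
    · exact Or.inl (mem_inE.2 ⟨hab, this.2 h, h, ha, hb⟩)
  have fin : ∀ h : Fin n, h ∈ C → (∀ p ∈ inE G c C, p.1 = h ∨ p.2 = h) →
      (k + 1 ≤ (Finset.univ.filter (fun b => b ∈ C ∧ G.Adj h b)).card) → 
      ∃ (h : Fin n) (L : Finset (Fin n)), h ∈ C ∧ h ∉ L ∧ (∀ b ∈ L, b ∈ C) ∧ k + 1 ≤ L.card ∧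
      ∀ a b, a ∈ C → b ∈ C → (G.Adj a b ↔ (a = h ∧ b ∈ L) ∨ (b = h ∧ a ∈ L)) := by
    intro h hh hp hcd
    refine ⟨h, _, hh, by simp, by simp; tauto, hcd, ?_⟩
    intro a b ha hb
    simp only [Finset.mem_filter, Finset.mem_univ, true_and]
    constructor
    · intro hab
      have hor : a = h ∨ b = h := by
        rcases horient a b ha hb hab with h1 | h1
        · exact hp _ h1
        · exact (hp _ h1).symm
      rcases hor with rfl | rfl
      · exact Or.inl ⟨rfl, hb, hab⟩
      · exact Or.inr ⟨rfl, ha, hab.symm⟩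
    · rintro (⟨rfl, h1, h2⟩ | ⟨rfl, h1, h2⟩)
      · exact h2
      · exact h2.symm
  obtain ⟨p0, hp0⟩ := hne
  have hp0' := mem_inE.1 hp0
  by_cases h1 : ∃ u, ∀ f ∈ inE G c C, f.1 = u
  · obtain ⟨u, hu⟩ := h1
    refine fin u (by rw [← hu _ hp0]; exact hp0'.2.2.2.1) (fun p hp => Or.inl (hu p hp)) ?_
    rw [← hcard]
    refine Finset.card_le_card_of_injOn Prod.snd ?_ ?_
    · intro p hp
      have := mem_inE.1 hp
      rw [hu p hp] at this
      simp only [Finset.coe_filter, Finset.mem_univ, true_and, Set.mem_setOf_eq]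
      exact ⟨this.2.2.2.2, this.1⟩
    · intro p hp q hq h
      exact Prod.ext ((hu p hp).trans (hu q hq).symm) h
  by_cases h2 : ∃ u, ∀ f ∈ inE G c C, f.2 = u
  · obtain ⟨u, hu⟩ := h2
    refine fin u (by rw [← hu _ hp0]; exact hp0'.2.2.2.2) (fun p hp => Or.inr (hu p hp)) ?_
    rw [← hcard]
    refine Finset.card_le_card_of_injOn Prod.fst ?_ ?_
    · intro p hp
      have := mem_inE.1 hp
      rw [hu p hp] at this
      simp only [Finset.coe_filter, Finset.mem_univ, true_and, Set.mem_setOf_eq]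
      exact ⟨this.2.2.2.1, this.1.symm⟩
    · intro p hp q hq h
      exact Prod.ext h ((hu p hp).trans (hu q hq).symm)
  · exfalso
    have := interN_nonstar _ ⟨p0, hp0⟩ h1 h2
    rw [hcard] at this
    have h3 : (interN (inE G c C) : ℝ) + 2 * (k + 1) ≤ (k + 1) ^ 2 + 6 := by exact_mod_cast this
    have hk' : (8 : ℝ) ≤ k := by exact_mod_cast hk
    nlinarith

/-- Two stars with `k+1` leaves joined by the edge `v w`. -/
structure TwoStars {n : ℕ} (G : SimpleGraph (Fin n)) (k : ℕ) (h1 h2 v w : Fin n)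
    (L1 L2 : Finset (Fin n)) : Prop where
  c1 : L1.card = k + 1
  c2 : L2.card = k + 1
  n11 : h1 ∉ L1
  n22 : h2 ∉ L2
  n12 : h1 ∉ L2
  n21 : h2 ∉ L1
  hne : h1 ≠ h2
  disj : ∀ a ∈ L1, a ∉ L2
  cover : ∀ a, a = h1 ∨ a = h2 ∨ a ∈ L1 ∨ a ∈ L2
  hv : v = h1 ∨ v ∈ L1
  hw : w = h2 ∨ w ∈ L2
  adj : ∀ a b, G.Adj a b ↔ ((a = h1 ∧ b ∈ L1) ∨ (b = h1 ∧ a ∈ L1) ∨ (a = h2 ∧ b ∈ L2) ∨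
    (b = h2 ∧ a ∈ L2) ∨ (a = v ∧ b = w) ∨ (a = w ∧ b = v))

set_option maxHeartbeats 1000000 in
lemma two_stars (k : ℕ) (hk : 8 ≤ k) (G : SimpleGraph (Fin (k + k + 4))) (hG : G.IsTree)
    (hl0 : 0 < lam 2 G) (hl : (k : ℝ) + 3 / 8 ≤ lam 2 G ^ 2) :
    ∃ h1 h2 v w L1 L2, TwoStars G k h1 h2 v w L1 L2 := by
  obtain ⟨c, hc⟩ := tree_sign G hG
  choose f hf hfI using branch (by omega) G hG c hc hl0
  have hE := hG.card_edgeFinset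
  rw [Fintype.card_fin] at hE
  obtain ⟨v, -, w, -, hvw, hs⟩ := Finset.exists_ne_map_eq_of_card_lt_of_maps_to
    (s := (Finset.univ : Finset (Fin (k + k + 4)))) (t := G.edgeFinset)
    (f := fun v => s(v, f v)) (by rw [Finset.card_univ, Fintype.card_fin]; omega)
    (by intro a _; simpa using hf a)
  have hfv : f v = w ∧ f w = v := by
    simp only [Sym2.eq_iff] at hs
    rcases hs with ⟨h, -⟩ | ⟨h, h'⟩
    · exact absurd h hvw
    · exact ⟨h', h.symm⟩
  have hIY := hfI v
  have hIX := hfI w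
  have hadj := hf v
  rw [hfv.1] at hIY hadj
  rw [hfv.2] at hIX
  set X : Set (Fin (k + k + 4)) := {u | (G.deleteIncidenceSet w).Reachable v u} with hX
  set Y : Set (Fin (k + k + 4)) := {u | (G.deleteIncidenceSet v).Reachable w u} with hY
  have hvX : v ∈ X := SimpleGraph.Reachable.refl _
  have hwY : w ∈ Y := SimpleGraph.Reachable.refl _
  have hdisj : ∀ a, a ∈ X → a ∉ Y := by
    intro a haX haY
    have hbr := SimpleGraph.isAcyclic_iff_forall_adj_isBridge.1 hG.isAcyclic hadj
    rw [SimpleGraph.isBridge_iff] at hbr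
    apply hbr
    have l1 : G.deleteIncidenceSet w ≤ G.deleteEdges {s(v, w)} := by
      intro a b hab
      rw [SimpleGraph.deleteIncidenceSet_adj] at hab
      rw [SimpleGraph.deleteEdges_adj]
      refine ⟨hab.1, ?_⟩
      simp only [Set.mem_singleton_iff, Sym2.eq_iff]
      tauto
    have l2 : G.deleteIncidenceSet v ≤ G.deleteEdges {s(v, w)} := by
      intro a b hab
      rw [SimpleGraph.deleteIncidenceSet_adj] at hab
      rw [SimpleGraph.deleteEdges_adj]
      refine ⟨hab.1, ?_⟩
      simp only [Set.mem_singleton_iff, Sym2.eq_iff]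
      tauto
    exact (SimpleGraph.Reachable.mono l1 haX).trans (SimpleGraph.Reachable.mono l2 haY).symm
  have hl4 : ((k : ℝ) + 3 / 8) ^ 2 ≤ lam 2 G ^ 4 := by
    calc ((k : ℝ) + 3 / 8) ^ 2 ≤ (lam 2 G ^ 2) ^ 2 := by gcongr
      _ = _ := by ring
  have hbig : ∀ C : Set (Fin (k + k + 4)), lam 2 G ^ 4 ≤ (interN (inE G c C) : ℝ) →
      k + 1 ≤ (inE G c C).card := by
    intro C hC
    by_contra hcon
    have h1 : (inE G c C).card ≤ k := by omega
    have h2 := (interN_le (inE G c C)).trans (Nat.pow_le_pow_left h1 2)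
    have h3 : (interN (inE G c C) : ℝ) ≤ (k : ℝ) ^ 2 := by exact_mod_cast h2
    have : (0 : ℝ) ≤ k := Nat.cast_nonneg _
    nlinarith
  have hbX := hbig X hIX
  have hbY := hbig Y hIY
  -- count the edges
  let m : Fin (k + k + 4) × Fin (k + k + 4) → Sym2 (Fin (k + k + 4)) := fun p => s(p.1, p.2)
  have minj : ∀ C, Set.InjOn m (inE G c C : Set (Fin (k + k + 4) × Fin (k + k + 4))) := by
    intro C p hp q hq hpq
    have hp' := mem_inE.1 hp
    have hq' := mem_inE.1 hq
    simp only [m, Sym2.eq_iff] at hpq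
    rcases hpq with ⟨h, h'⟩ | ⟨h, h'⟩
    · exact Prod.ext h h'
    · exact absurd (h ▸ hp'.2.1) hq'.2.2.1
  set U := (inE G c X).image m ∪ (inE G c Y).image m ∪ {s(v, w)} with hU
  have hUsub : U ⊆ G.edgeFinset := by
    intro e he
    simp only [hU, Finset.mem_union, Finset.mem_image, Finset.mem_singleton] at he
    rcases he with (⟨p, hp, rfl⟩ | ⟨p, hp, rfl⟩) | rfl
    · simpa [m] using (mem_inE.1 hp).1
    · simpa [m] using (mem_inE.1 hp).1
    · simpa using hadj
  have hUcard : U.card = (inE G c X).card + (inE G c Y).card + 1 := by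
    rw [hU, Finset.card_union_of_disjoint, Finset.card_union_of_disjoint,
      Finset.card_image_of_injOn (minj X), Finset.card_image_of_injOn (minj Y),
      Finset.card_singleton]
    · rw [Finset.disjoint_left]
      intro e he he'
      simp only [Finset.mem_image] at he he'
      obtain ⟨p, hp, rfl⟩ := he
      obtain ⟨q, hq, hpq⟩ := he'
      have hp' := mem_inE.1 hp
      have hq' := mem_inE.1 hq
      simp only [m, Sym2.eq_iff] at hpq
      rcases hpq with ⟨h, h'⟩ | ⟨h, h'⟩
      · exact hdisj p.1 hp'.2.2.2.1 (h ▸ hq'.2.2.2.1)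
      · exact hdisj p.1 hp'.2.2.2.1 (h' ▸ hq'.2.2.2.2)
    · rw [Finset.disjoint_left]
      intro e he he'
      simp only [Finset.mem_union, Finset.mem_image, Finset.mem_singleton] at he he'
      rcases he with ⟨p, hp, rfl⟩ | ⟨p, hp, rfl⟩
      · have hp' := mem_inE.1 hp
        simp only [m, Sym2.eq_iff] at he'
        rcases he' with ⟨h, h'⟩ | ⟨h, h'⟩
        · exact hdisj w (h' ▸ hp'.2.2.2.2) hwY
        · exact hdisj w (h ▸ hp'.2.2.2.1) hwY
      · have hp' := mem_inE.1 hp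
        simp only [m, Sym2.eq_iff] at he'
        rcases he' with ⟨h, h'⟩ | ⟨h, h'⟩
        · exact hdisj v hvX (h ▸ hp'.2.2.2.1)
        · exact hdisj v hvX (h' ▸ hp'.2.2.2.2)
  have hle := Finset.card_le_card hUsub
  have hcX : (inE G c X).card = k + 1 := by omega
  have hcY : (inE G c Y).card = k + 1 := by omega
  have hUeq : U = G.edgeFinset := Finset.eq_of_subset_of_card_le hUsub (by omega)
  obtain ⟨h1, L1, h1X, h1L, hL1, hL1c, hA1⟩ := star_of G c hc X k hk hcX (hl4.trans hIX)
  obtain ⟨h2, L2, h2Y, h2L, hL2, hL2c, hA2⟩ := star_of G c hc Y k hk hcY (hl4.trans hIY)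
  have hLd : ∀ a ∈ L1, a ∉ L2 := fun a ha ha' => hdisj a (hL1 a ha) (hL2 a ha')
  have hcardW : (insert h1 L1 ∪ insert h2 L2).card = L1.card + 1 + (L2.card + 1) := by
    rw [Finset.card_union_of_disjoint, Finset.card_insert_of_notMem h1L,
      Finset.card_insert_of_notMem h2L]
    rw [Finset.disjoint_left]
    intro a ha ha'
    rw [Finset.mem_insert] at ha ha'
    have q1 : a ∈ X := by
      rcases ha with rfl | ha
      · exact h1X
      · exact hL1 a ha
    have q2 : a ∈ Y := by
      rcases ha' with rfl | ha'
      · exact h2Y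
      · exact hL2 a ha'
    exact hdisj a q1 q2
  have hW := Finset.card_le_univ (insert h1 L1 ∪ insert h2 L2)
  rw [Fintype.card_fin] at hW
  have hWu : insert h1 L1 ∪ insert h2 L2 = Finset.univ := by
    apply Finset.eq_univ_of_card
    rw [Fintype.card_fin]; omega
  have cover : ∀ a, a = h1 ∨ a = h2 ∨ a ∈ L1 ∨ a ∈ L2 := by
    intro a
    have : a ∈ insert h1 L1 ∪ insert h2 L2 := by rw [hWu]; simp
    simp only [Finset.mem_union, Finset.mem_insert] at this
    tauto
  refine ⟨h1, h2, v, w, L1, L2, by omega, by omega, h1L, h2L, fun h => hdisj _ h1X (hL2 _ h),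
    fun h => hdisj _ (hL1 _ h) h2Y, fun h => hdisj _ h1X (h ▸ h2Y), hLd, cover, ?_, ?_, ?_⟩
  · rcases cover v with h | h | h | h
    · exact Or.inl h
    · exact absurd (h ▸ h2Y) (hdisj v hvX)
    · exact Or.inr h
    · exact absurd (hL2 _ h) (hdisj v hvX)
  · rcases cover w with h | h | h | h
    · exact absurd hwY (hdisj w (h ▸ h1X))
    · exact Or.inl h
    · exact absurd hwY (hdisj w (hL1 _ h))
    · exact Or.inr h
  · intro a b
    constructor
    · intro hab
      have he : s(a, b) ∈ U := by rw [hUeq]; simpa using hab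
      simp only [hU, Finset.mem_union, Finset.mem_image, Finset.mem_singleton, m, Sym2.eq_iff] at he
      rcases he with (⟨p, hp, h⟩ | ⟨p, hp, h⟩) | h
      · have hp' := mem_inE.1 hp
        have : a ∈ X ∧ b ∈ X := by
          rcases h with ⟨rfl, rfl⟩ | ⟨rfl, rfl⟩
          · exact ⟨hp'.2.2.2.1, hp'.2.2.2.2⟩
          · exact ⟨hp'.2.2.2.2, hp'.2.2.2.1⟩
        rcases (hA1 a b this.1 this.2).1 hab with q | q
        · exact Or.inl q
        · exact Or.inr (Or.inl q)
      · have hp' := mem_inE.1 hp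
        have : a ∈ Y ∧ b ∈ Y := by
          rcases h with ⟨rfl, rfl⟩ | ⟨rfl, rfl⟩
          · exact ⟨hp'.2.2.2.1, hp'.2.2.2.2⟩
          · exact ⟨hp'.2.2.2.2, hp'.2.2.2.1⟩
        rcases (hA2 a b this.1 this.2).1 hab with q | q
        · exact Or.inr (Or.inr (Or.inl q))
        · exact Or.inr (Or.inr (Or.inr (Or.inl q)))
      · exact Or.inr (Or.inr (Or.inr (Or.inr h)))
    · rintro (⟨rfl, h⟩ | ⟨rfl, h⟩ | ⟨rfl, h⟩ | ⟨rfl, h⟩ | ⟨rfl, rfl⟩ | ⟨rfl, rfl⟩)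
      · exact (hA1 _ _ h1X (hL1 _ h)).2 (Or.inl ⟨rfl, h⟩)
      · exact (hA1 _ _ (hL1 _ h) h1X).2 (Or.inr ⟨rfl, h⟩)
      · exact (hA2 _ _ h2Y (hL2 _ h)).2 (Or.inl ⟨rfl, h⟩)
      · exact (hA2 _ _ (hL2 _ h) h2Y).2 (Or.inr ⟨rfl, h⟩)
      · exact hadj
      · exact hadj.symm

end PartC

section PartD

/-- `G` is a blow-up of the path on `m` labels, with fibre sizes `c`. -/
structure Lab {n m : ℕ} (G : SimpleGraph (Fin n)) (c : Fin m → ℕ) (τ : Fin n → Fin m) : Prop where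
  adj : ∀ a b, G.Adj a b ↔ ((τ a).val + 1 = (τ b).val ∨ (τ b).val + 1 = (τ a).val)
  card : ∀ l, (Finset.univ.filter (fun a => τ a = l)).card = c l

/-- consecutive labels -/
noncomputable def R01 {m : ℕ} (l l' : Fin m) : ℝ :=
  if (l.val + 1 = l'.val ∨ l'.val + 1 = l.val) then 1 else 0

lemma Lab.iso {n n' m : ℕ} {G : SimpleGraph (Fin n)} {G' : SimpleGraph (Fin n')} {c : Fin m → ℕ}
    {τ : Fin n → Fin m} {τ' : Fin n' → Fin m} (h : Lab G c τ) (h' : Lab G' c τ') :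
    Nonempty (G ≃g G') := by
  have e : ∀ l, Nonempty ({a // τ a = l} ≃ {a // τ' a = l}) := by
    intro l
    refine ⟨Fintype.equivOfCardEq ?_⟩
    rw [Fintype.card_subtype, Fintype.card_subtype, h.card, h'.card]
  let e' : ∀ l, ({a // τ a = l} ≃ {a // τ' a = l}) := fun l => (e l).some
  let E : Fin n ≃ Fin n' := (Equiv.sigmaFiberEquiv τ).symm.trans
    ((Equiv.sigmaCongrRight e').trans (Equiv.sigmaFiberEquiv τ'))
  have hE : ∀ a, τ' (E a) = τ a := by
    intro a
    exact (e' (τ a) ⟨a, rfl⟩).2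
  refine ⟨⟨E, ?_⟩⟩
  intro a b
  rw [h.adj, h'.adj, hE, hE]

lemma Lab.adjMat_eq {n m : ℕ} {G : SimpleGraph (Fin n)} {c : Fin m → ℕ}
    {τ : Fin n → Fin m} (h : Lab G c τ) (a b : Fin n) : adjMat G a b = R01 (τ a) (τ b) := by
  simp only [adjMat, R01, h.adj]

lemma Lab.sum_eq {n m : ℕ} {G : SimpleGraph (Fin n)} {c : Fin m → ℕ}
    {τ : Fin n → Fin m} (h : Lab G c τ) (x : Fin n → ℝ) (a : Fin n) :
    ∑ b, adjMat G a b * x b = ∑ l, R01 (τ a) l * ∑ b with τ b = l, x b := by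
  rw [← Finset.sum_fiberwise Finset.univ τ]
  refine Finset.sum_congr rfl fun l _ => ?_
  rw [Finset.mul_sum]
  refine Finset.sum_congr rfl fun b hb => ?_
  rw [h.adjMat_eq, (Finset.mem_filter.1 hb).2]

lemma Lab.vec {n m : ℕ} {G : SimpleGraph (Fin n)} {c : Fin m → ℕ}
    {τ : Fin n → Fin m} (h : Lab G c τ) (μ : ℝ) (y : Fin m → ℝ)
    (hy : ∀ l, ∑ l', R01 l l' * (c l' * y l') = μ * y l) (a : Fin n) :
    ∑ b, adjMat G a b * y (τ b) = μ * y (τ a) := by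
  rw [h.sum_eq (fun b => y (τ b)), ← hy]
  refine Finset.sum_congr rfl fun l _ => ?_
  congr 1
  rw [← h.card l, Finset.sum_congr rfl (g := fun _ => y l)
    (fun b hb => by rw [(Finset.mem_filter.1 hb).2])]
  simp

lemma Lab.quot {n m : ℕ} {G : SimpleGraph (Fin n)} {c : Fin m → ℕ}
    {τ : Fin n → Fin m} (h : Lab G c τ) (μ : ℝ) (hμ : μ ≠ 0) (x : Fin n → ℝ) (hx0 : x ≠ 0)
    (hx : ∀ a, ∑ b, adjMat G a b * x b = μ * x a) :
    ∃ s : Fin m → ℝ, s ≠ 0 ∧ ∀ l, μ * s l = c l * ∑ l', R01 l l' * s l' := by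
  refine ⟨fun l => ∑ b with τ b = l, x b, ?_, ?_⟩
  · intro hs
    apply hx0
    funext a
    have h1 := h.sum_eq x a
    rw [hx a] at h1
    have h2 : μ * x a = 0 := by
      rw [h1]
      refine Finset.sum_eq_zero fun l _ => ?_
      have := congrFun hs l
      simp only [Pi.zero_apply] at this
      rw [this, mul_zero]
    simpa [hμ] using h2
  · intro l
    show μ * ∑ b with τ b = l, x b = c l * ∑ l', R01 l l' * ∑ b with τ b = l', x b
    rw [Finset.mul_sum, Finset.sum_congr rfl
      (g := fun _ => ∑ l', R01 l l' * ∑ b with τ b = l', x b)]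
    · rw [Finset.sum_const, h.card, nsmul_eq_mul]
    · intro a ha
      rw [← hx a, h.sum_eq x a, (Finset.mem_filter.1 ha).2]

/-- fibre sizes for `DC(k,k+1,3)` -/
def c3 (k : ℕ) : Fin 5 → ℕ := ![k, 1, 1, 1, k + 1]
/-- fibre sizes for `DC(k,k,4)` -/
def c4 (k : ℕ) : Fin 6 → ℕ := ![k, 1, 1, 1, 1, k]

lemma card_Ico {n : ℕ} (P : Fin n → Prop) [DecidablePred P] (A B : ℕ) (hB : B ≤ n)
    (h : ∀ a : Fin n, P a ↔ A ≤ a.val ∧ a.val < B) :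
    (Finset.univ.filter P).card = B - A := by
  rw [← Nat.card_Ico, ← Finset.card_map Fin.valEmbedding]
  congr 1
  ext i
  simp only [Finset.mem_map, Finset.mem_filter, Finset.mem_univ, true_and, Finset.mem_Ico,
    Fin.valEmbedding_apply]
  constructor
  · rintro ⟨a, ha, rfl⟩
    exact (h a).1 ha
  · intro hi
    exact ⟨⟨i, by omega⟩, (h _).2 hi, rfl⟩

lemma dc3_lab (k : ℕ) : ∃ τ, Lab (doubleComet k (k + 1) 3) (c3 k) τ := by
  let τ : Fin (k + (k + 1) + 3) → Fin 5 := fun i =>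
    if i.val < 3 then ⟨min (i.val + 1) 4, by omega⟩ else if i.val < 3 + k then 0 else 4
  have hτ : ∀ i, (i.val < 3 ∧ (τ i).val = i.val + 1) ∨ (3 ≤ i.val ∧ i.val < 3 + k ∧ (τ i).val = 0)
      ∨ (3 + k ≤ i.val ∧ (τ i).val = 4) := by
    intro i
    simp only [τ]
    split_ifs with h1 h2
    · left; simp; omega
    · right; left; simp; omega
    · right; right; simp; omega
  refine ⟨τ, ?_, ?_⟩
  · intro a b
    simp only [doubleComet, SimpleGraph.fromRel_adj, ne_eq, Fin.ext_iff]
    have := hτ a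
    have := hτ b
    have := a.2
    have := b.2
    omega
  · intro l
    fin_cases l <;> simp only []
    · rw [card_Ico _ 3 (3 + k) (by omega)]
      · simp [c3]
      · intro a; rw [Fin.ext_iff]; have := a.2; have := hτ a; simp only []; omega
    · rw [card_Ico _ 0 1 (by omega)]
      · simp [c3]
      · intro a; rw [Fin.ext_iff]; have := a.2; have := hτ a; simp only []; omega
    · rw [card_Ico _ 1 2 (by omega)]
      · simp [c3]
      · intro a; rw [Fin.ext_iff]; have := a.2; have := hτ a; simp only []; omega
    · rw [card_Ico _ 2 3 (by omega)]
      · simp [c3]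
      · intro a; rw [Fin.ext_iff]; have := a.2; have := hτ a; simp only []; omega
    · rw [card_Ico _ (3 + k) (k + (k + 1) + 3) (by omega)]
      · simp [c3]; omega
      · intro a; rw [Fin.ext_iff]; have := a.2; have := hτ a; simp only []; omega

lemma dc4_lab (k : ℕ) : ∃ τ, Lab (doubleComet k k 4) (c4 k) τ := by
  let τ : Fin (k + k + 4) → Fin 6 := fun i =>
    if i.val < 4 then ⟨min (i.val + 1) 5, by omega⟩ else if i.val < 4 + k then 0 else 5
  have hτ : ∀ i, (i.val < 4 ∧ (τ i).val = i.val + 1) ∨ (4 ≤ i.val ∧ i.val < 4 + k ∧ (τ i).val = 0)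
      ∨ (4 + k ≤ i.val ∧ (τ i).val = 5) := by
    intro i
    simp only [τ]
    split_ifs with h1 h2
    · left; simp; omega
    · right; left; simp; omega
    · right; right; simp; omega
  refine ⟨τ, ?_, ?_⟩
  · intro a b
    simp only [doubleComet, SimpleGraph.fromRel_adj, ne_eq, Fin.ext_iff]
    have := hτ a
    have := hτ b
    have := a.2
    have := b.2
    omega
  · intro l
    fin_cases l <;> simp only []
    · rw [card_Ico _ 4 (4 + k) (by omega)]
      · simp [c4]
      · intro a; rw [Fin.ext_iff]; have := a.2; have := hτ a; simp only []; omega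
    · rw [card_Ico _ 0 1 (by omega)]
      · simp [c4]
      · intro a; rw [Fin.ext_iff]; have := a.2; have := hτ a; simp only []; omega
    · rw [card_Ico _ 1 2 (by omega)]
      · simp [c4]
      · intro a; rw [Fin.ext_iff]; have := a.2; have := hτ a; simp only []; omega
    · rw [card_Ico _ 2 3 (by omega)]
      · simp [c4]
      · intro a; rw [Fin.ext_iff]; have := a.2; have := hτ a; simp only []; omega
    · rw [card_Ico _ 3 4 (by omega)]
      · simp [c4]
      · intro a; rw [Fin.ext_iff]; have := a.2; have := hτ a; simp only []; omega
    · rw [card_Ico _ (4 + k) (k + k + 4) (by omega)]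
      · simp [c4]; omega
      · intro a; rw [Fin.ext_iff]; have := a.2; have := hτ a; simp only []; omega

lemma tree_of_parent {n : ℕ} (hn : 0 < n) (G : SimpleGraph (Fin n)) (p : ℕ → ℕ)
    (hp : ∀ i, 0 < i → p i < i)
    (hG : ∀ a b : Fin n, G.Adj a b ↔ (0 < b.val ∧ a.val = p b.val) ∨ (0 < a.val ∧ b.val = p a.val)) :
    G.IsTree := by
  have hreach : ∀ i (hi : i < n), G.Reachable ⟨0, hn⟩ ⟨i, hi⟩ := by
    intro i
    induction i using Nat.strong_induction_on with
    | _ i ih =>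
      intro hi
      rcases Nat.eq_zero_or_pos i with rfl | h0
      · exact SimpleGraph.Reachable.refl _
      · have := hp i h0
        refine (ih (p i) this (by omega)).trans (SimpleGraph.Adj.reachable ?_)
        rw [hG]
        exact Or.inl ⟨h0, rfl⟩
  have hconn : G.Connected := by
    have : Nonempty (Fin n) := ⟨⟨0, hn⟩⟩
    refine SimpleGraph.Connected.mk ?_
    intro a b
    exact (hreach a.1 a.2).symm.trans (hreach b.1 b.2)
  rw [SimpleGraph.isTree_iff_connected_and_card]
  refine ⟨hconn, ?_⟩
  have h1 := hconn.card_vert_le_card_edgeSet_add_one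
  have h2 : Nat.card G.edgeSet ≤ n - 1 := by
    rw [Nat.card_eq_fintype_card, ← SimpleGraph.edgeFinset_card]
    have hsub : G.edgeFinset ⊆ (Finset.univ.filter (fun a : Fin n => 0 < a.val)).image
        (fun a => s(a, if h : p a.val < n then ⟨p a.val, h⟩ else a)) := by
      intro e he
      induction e using Sym2.ind with
      | _ a b =>
        rw [SimpleGraph.mem_edgeFinset, SimpleGraph.mem_edgeSet, hG] at he
        rw [Finset.mem_image]
        rcases he with ⟨h, h'⟩ | ⟨h, h'⟩
        · refine ⟨b, by simpa using h, ?_⟩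
          have : p b.val < n := h' ▸ a.2
          rw [dif_pos this, Sym2.eq_swap]
          have e : (⟨p b.val, this⟩ : Fin n) = a := Fin.ext h'.symm
          rw [e]
        · refine ⟨a, by simpa using h, ?_⟩
          have : p a.val < n := h' ▸ b.2
          rw [dif_pos this]
          have e : (⟨p a.val, this⟩ : Fin n) = b := Fin.ext h'.symm
          rw [e]
    refine (Finset.card_le_card hsub).trans (Finset.card_image_le.trans ?_)
    rw [card_Ico _ 1 n le_rfl]
    intro a
    have := a.2
    omega
  have h3 : Nat.card (Fin n) = n := by simp
  omega

lemma dc3_tree (k : ℕ) : (doubleComet k (k + 1) 3).IsTree := by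
  refine tree_of_parent (by omega) _
    (fun i => if i < 3 then i - 1 else if i < 3 + k then 0 else 2) ?_ ?_
  · intro i hi
    split_ifs <;> omega
  · intro a b
    simp only [doubleComet, SimpleGraph.fromRel_adj, ne_eq, Fin.ext_iff]
    have := a.2
    have := b.2
    split_ifs <;> omega

lemma dc4_tree (k : ℕ) : (doubleComet k k 4).IsTree := by
  refine tree_of_parent (by omega) _
    (fun i => if i < 4 then i - 1 else if i < 4 + k then 0 else 3) ?_ ?_
  · intro i hi
    split_ifs <;> omega
  · intro a b
    simp only [doubleComet, SimpleGraph.fromRel_adj, ne_eq, Fin.ext_iff]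
    have := a.2
    have := b.2
    split_ifs <;> omega

lemma exists_dc3 (k : ℕ) : ∃ G : SimpleGraph (Fin (k + k + 4)), G.IsTree ∧ ∃ τ, Lab G (c3 k) τ := by
  have : ∀ n, k + (k + 1) + 3 = n →
      ∃ G : SimpleGraph (Fin n), G.IsTree ∧ ∃ τ, Lab G (c3 k) τ := by
    rintro _ rfl
    exact ⟨_, dc3_tree k, dc3_lab k⟩
  exact this _ (by omega)

end PartD

section PartG

lemma TwoStars.symm {n : ℕ} {G : SimpleGraph (Fin n)} {k : ℕ} {h1 h2 v w : Fin n}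
    {L1 L2 : Finset (Fin n)} (T : TwoStars G k h1 h2 v w L1 L2) :
    TwoStars G k h2 h1 w v L2 L1 where
  c1 := T.c2
  c2 := T.c1
  n11 := T.n22
  n22 := T.n11
  n12 := T.n21
  n21 := T.n12
  hne := T.hne.symm
  disj := fun a h h' => T.disj a h' h
  cover := fun a => by have := T.cover a; tauto
  hv := T.hw
  hw := T.hv
  adj := fun a b => by rw [T.adj]; tauto

lemma TwoStars.lab2 {n : ℕ} {G : SimpleGraph (Fin n)} {k : ℕ} {h1 h2 v w : Fin n}
    {L1 L2 : Finset (Fin n)} (T : TwoStars G k h1 h2 v w L1 L2) (hv : v = h1) (hw : w = h2) :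
    ∃ τ, Lab G (![k + 1, 1, 1, k + 1] : Fin 4 → ℕ) τ := by
  subst hv hw
  let τ : Fin n → Fin 4 := fun a => if a ∈ L1 then 0 else if a = v then 1 else if a = w then 2 else 3
  have hτ : ∀ a, (a ∈ L1 ∧ a ∉ L2 ∧ a ≠ v ∧ a ≠ w ∧ τ a = 0) ∨ (a = v ∧ τ a = 1) ∨
      (a = w ∧ τ a = 2) ∨ (a ∉ L1 ∧ a ∈ L2 ∧ a ≠ v ∧ a ≠ w ∧ τ a = 3) := by
    intro a
    have h1 := T.cover a
    have h2 := T.disj a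
    have := T.n11
    have := T.n22
    have := T.n12
    have := T.n21
    have := T.hne
    simp only [τ]
    grind
  have n11 := T.n11
  have n22 := T.n22
  have n12 := T.n12
  have n21 := T.n21
  have hne := T.hne
  refine ⟨τ, ?_, ?_⟩
  · intro a b
    rw [T.adj]
    rcases hτ a with ⟨p1, p2, p3, p4, p⟩ | ⟨rfl, p⟩ | ⟨rfl, p⟩ | ⟨p1, p2, p3, p4, p⟩ <;>
    rcases hτ b with ⟨q1, q2, q3, q4, q⟩ | ⟨rfl, q⟩ | ⟨rfl, q⟩ | ⟨q1, q2, q3, q4, q⟩ <;>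
    simp only [p, q] <;> grind
  · intro l
    have : ∀ l, Finset.univ.filter (fun a => τ a = l) =
        (![L1, {v}, {w}, L2] : Fin 4 → Finset (Fin n)) l := by
      intro l
      ext a
      have := hτ a
      fin_cases l <;> simp <;> grind
    rw [this]
    fin_cases l <;> simp [T.c1, T.c2]

lemma TwoStars.lab3 {n : ℕ} {G : SimpleGraph (Fin n)} {k : ℕ} {h1 h2 v w : Fin n}
    {L1 L2 : Finset (Fin n)} (T : TwoStars G k h1 h2 v w L1 L2) (hv : v ∈ L1) (hw : w = h2) :
    ∃ τ, Lab G (c3 k) τ := by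
  subst hw
  let τ : Fin n → Fin 5 := fun a => if a = v then 2 else if a ∈ L1 then 0 else if a = h1 then 1
    else if a = w then 3 else 4
  have n11 := T.n11
  have n22 := T.n22
  have n12 := T.n12
  have n21 := T.n21
  have hne := T.hne
  have nv := T.disj v hv
  have v1 : v ≠ h1 := fun h => n11 (h ▸ hv)
  have v2 : v ≠ w := fun h => n21 (h ▸ hv)
  have hτ : ∀ a, (a ∈ L1 ∧ a ∉ L2 ∧ a ≠ v ∧ a ≠ w ∧ a ≠ h1 ∧ τ a = 0) ∨ (a = h1 ∧ τ a = 1) ∨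
      (a = v ∧ τ a = 2) ∨ (a = w ∧ τ a = 3) ∨
      (a ∉ L1 ∧ a ∈ L2 ∧ a ≠ v ∧ a ≠ w ∧ a ≠ h1 ∧ τ a = 4) := by
    intro a
    have h2 := T.disj a
    simp only [τ]
    by_cases e1 : a = v
    · grind
    by_cases e2 : a = w
    · grind
    rcases T.cover a with h | h | h | h <;> grind
  refine ⟨τ, ?_, ?_⟩
  · intro a b
    rw [T.adj]
    rcases hτ a with ⟨p1, p2, p3, p4, p5, p⟩ | ⟨rfl, p⟩ | ⟨rfl, p⟩ | ⟨rfl, p⟩ |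
      ⟨p1, p2, p3, p4, p5, p⟩ <;>
    rcases hτ b with ⟨q1, q2, q3, q4, q5, q⟩ | ⟨rfl, q⟩ | ⟨rfl, q⟩ | ⟨rfl, q⟩ |
      ⟨q1, q2, q3, q4, q5, q⟩ <;>
    simp only [p, q] <;> grind
  · intro l
    have : ∀ l, Finset.univ.filter (fun a => τ a = l) =
        (![L1.erase v, {h1}, {v}, {w}, L2] : Fin 5 → Finset (Fin n)) l := by
      intro l
      ext a
      have := hτ a
      fin_cases l <;> simp <;> grind
    rw [this]
    fin_cases l <;> simp [T.c1, T.c2, c3, hv]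

lemma TwoStars.lab4 {n : ℕ} {G : SimpleGraph (Fin n)} {k : ℕ} {h1 h2 v w : Fin n}
    {L1 L2 : Finset (Fin n)} (T : TwoStars G k h1 h2 v w L1 L2) (hv : v ∈ L1) (hw : w ∈ L2) :
    ∃ τ, Lab G (c4 k) τ := by
  let τ : Fin n → Fin 6 := fun a => if a = v then 2 else if a = w then 3 else
    if a ∈ L1 then 0 else if a = h1 then 1 else if a = h2 then 4 else 5
  have n11 := T.n11
  have n22 := T.n22
  have n12 := T.n12
  have n21 := T.n21
  have hne := T.hne
  have nv := T.disj v hv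
  have nw : w ∉ L1 := fun h => T.disj w h hw
  have v1 : v ≠ h1 := fun h => n11 (h ▸ hv)
  have v2 : v ≠ h2 := fun h => n21 (h ▸ hv)
  have w1 : w ≠ h1 := fun h => n12 (h ▸ hw)
  have w2 : w ≠ h2 := fun h => n22 (h ▸ hw)
  have vw : v ≠ w := fun h => nv (h ▸ hw)
  have hτ : ∀ a, (a ∈ L1 ∧ a ∉ L2 ∧ a ≠ v ∧ a ≠ w ∧ a ≠ h1 ∧ a ≠ h2 ∧ τ a = 0) ∨
      (a = h1 ∧ τ a = 1) ∨
      (a = v ∧ τ a = 2) ∨ (a = w ∧ τ a = 3) ∨ (a = h2 ∧ τ a = 4) ∨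
      (a ∉ L1 ∧ a ∈ L2 ∧ a ≠ v ∧ a ≠ w ∧ a ≠ h1 ∧ a ≠ h2 ∧ τ a = 5) := by
    intro a
    have h2 := T.disj a
    simp only [τ]
    by_cases e1 : a = v
    · grind
    by_cases e2 : a = w
    · grind
    rcases T.cover a with h | h | h | h <;> grind
  refine ⟨τ, ?_, ?_⟩
  · intro a b
    rw [T.adj]
    rcases hτ a with ⟨p1, p2, p3, p4, p5, p6, p⟩ | ⟨rfl, p⟩ | ⟨rfl, p⟩ | ⟨rfl, p⟩ | ⟨rfl, p⟩ |
      ⟨p1, p2, p3, p4, p5, p6, p⟩ <;>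
    rcases hτ b with ⟨q1, q2, q3, q4, q5, q6, q⟩ | ⟨rfl, q⟩ | ⟨rfl, q⟩ | ⟨rfl, q⟩ | ⟨rfl, q⟩ |
      ⟨q1, q2, q3, q4, q5, q6, q⟩ <;>
    simp only [p, q] <;> grind
  · intro l
    have : ∀ l, Finset.univ.filter (fun a => τ a = l) =
        (![L1.erase v, {h1}, {v}, {w}, {h2}, L2.erase w] : Fin 6 → Finset (Fin n)) l := by
      intro l
      ext a
      have := hτ a
      fin_cases l <;> simp <;> grind
    rw [this]
    fin_cases l <;> simp [T.c1, T.c2, c4, hv, hw]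

end PartG

section PartF

lemma F1' (k : ℕ) (G : SimpleGraph (Fin (k + k + 4))) (hG : G.IsTree) :
    (max (lam 1 G) 0) ^ 2 + (max (lam 2 G) 0) ^ 2 ≤ 2 * (k : ℝ) + 3 := by
  have := F1 (by omega) G hG
  push_cast at this
  linarith

lemma ne_zero_of_label {n m : ℕ} {G : SimpleGraph (Fin n)} {c : Fin m → ℕ}
    {τ : Fin n → Fin m} (h : Lab G c τ) (y : Fin m → ℝ) (l : Fin m) (hl : 0 < c l)
    (hy : y l ≠ 0) : (fun a => y (τ a)) ≠ 0 := by
  intro h0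
  rw [← h.card l, Finset.card_pos] at hl
  obtain ⟨a, ha⟩ := hl
  apply hy
  have := congrFun h0 a
  rw [← (Finset.mem_filter.1 ha).2]
  exact this

lemma lam_vec_ne {n : ℕ} (hn : 2 ≤ n) (G : SimpleGraph (Fin n)) :
    (∃ x : Fin n → ℝ, x ≠ 0 ∧ ∀ a, ∑ b, adjMat G a b * x b = lam 1 G * x a) ∧
    (∃ x : Fin n → ℝ, x ≠ 0 ∧ ∀ a, ∑ b, adjMat G a b * x b = lam 2 G * x a) := by
  obtain ⟨x, y, hxx, hyy, -, hx, hy⟩ := lam_vec hn G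
  refine ⟨⟨x, ?_, hx⟩, ⟨y, ?_, hy⟩⟩
  · rintro rfl; simp at hxx
  · rintro rfl; simp at hyy

lemma lab2_false (k : ℕ) (hk : 8 ≤ k) (G : SimpleGraph (Fin (k + k + 4))) (hG : G.IsTree)
    (hl0 : 0 < lam 2 G) (hl : (k : ℝ) + 3 / 8 ≤ lam 2 G ^ 2) {τ}
    (h : Lab G (![k + 1, 1, 1, k + 1] : Fin 4 → ℕ) τ) : False := by
  have hF := F1' k G hG
  have hanti := lam_anti (by omega) G
  rw [max_eq_left hl0.le, max_eq_left (hl0.le.trans hanti)] at hF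
  obtain ⟨-, x, hx0, hx⟩ := lam_vec_ne (by omega) G
  obtain ⟨s, hs0, hs⟩ := h.quot _ hl0.ne' x hx0 hx
  set μ := lam 2 G with hμ
  have e0 := hs 0
  have e1 := hs 1
  have e2 := hs 2
  have e3 := hs 3
  simp [Fin.sum_univ_succ, R01] at e0 e1 e2 e3
  have hk' : (8 : ℝ) ≤ k := by exact_mod_cast hk
  have hup : μ ^ 2 ≤ k + 3 / 2 := by nlinarith
  have q1 : (μ ^ 2 - k - 1) * s 1 = μ * s 2 := by linear_combination e0 + μ * e1
  have q2 : (μ ^ 2 - k - 1) * s 2 = μ * s 1 := by linear_combination e3 + μ * e2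
  have hpos : 0 < μ ^ 2 - (μ ^ 2 - k - 1) ^ 2 := by nlinarith
  have z1 : s 1 = 0 := by
    have : (μ ^ 2 - (μ ^ 2 - k - 1) ^ 2) * s 1 = 0 := by
      linear_combination (-(μ ^ 2 - k - 1)) * q1 - μ * q2
    exact (mul_eq_zero.1 this).resolve_left hpos.ne'
  have z2 : s 2 = 0 := by
    have : μ * s 2 = 0 := by rw [← q1, z1, mul_zero]
    exact (mul_eq_zero.1 this).resolve_left hl0.ne'
  have z0 : s 0 = 0 := by rw [z1, z2] at e1; linarith
  have z3 : s 3 = 0 := by rw [z1, z2] at e2; linarith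
  apply hs0
  funext l
  fin_cases l <;> simp [z0, z1, z2, z3]

lemma lab3_eig (k : ℕ) {n : ℕ} {G : SimpleGraph (Fin n)} {τ}
    (h : Lab G (c3 k) τ) (t μ : ℝ) (hμ : 0 < μ) (ht : t ^ 2 = t + 1) (hm : μ ^ 2 = k + 1 + t) :
    ∃ x : Fin n → ℝ, x ≠ 0 ∧ ∀ a, ∑ b, adjMat G a b * x b = μ * x a := by
  set y : Fin 5 → ℝ := ![1 / μ, 1, (1 + t) / μ, t, t / μ] with hy
  refine ⟨fun a => y (τ a), ne_zero_of_label h y 1 (by simp [c3]) (by simp [hy]),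
    h.vec μ y ?_⟩
  intro l
  fin_cases l <;> simp [Fin.sum_univ_succ, R01, hy, c3] <;> field_simp
  · linarith
  · linear_combination (-t) * hm - ht

lemma lab3_lower (k : ℕ) {G : SimpleGraph (Fin (k + k + 4))} {τ} (h : Lab G (c3 k) τ) :
    √(k + 1 + (1 + √5) / 2) ≤ lam 1 G ∧ √(k + 1 + (1 - √5) / 2) ≤ lam 2 G := by
  have s5 : √5 ^ 2 = (5 : ℝ) := Real.sq_sqrt (by norm_num)
  have s0 : (0 : ℝ) < √5 := Real.sqrt_pos.2 (by norm_num)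
  have s3 : √5 < (3 : ℝ) := by nlinarith
  have hk0 : (0 : ℝ) ≤ k := Nat.cast_nonneg _
  have hp1 : 0 < (k : ℝ) + 1 + (1 + √5) / 2 := by linarith
  have hp2 : 0 < (k : ℝ) + 1 + (1 - √5) / 2 := by linarith
  obtain ⟨x, hx0, hx⟩ := lab3_eig k h ((1 + √5) / 2) (√(k + 1 + (1 + √5) / 2))
    (Real.sqrt_pos.2 hp1) (by nlinarith) (Real.sq_sqrt hp1.le)
  obtain ⟨y, hy0, hy⟩ := lab3_eig k h ((1 - √5) / 2) (√(k + 1 + (1 - √5) / 2))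
    (Real.sqrt_pos.2 hp2) (by nlinarith) (Real.sq_sqrt hp2.le)
  exact lam_lower (by omega) G _ _ (Real.sqrt_lt_sqrt hp2.le (by linarith)) x y hx0 hy0 hx hy

lemma lab4_eig (k : ℕ) {n : ℕ} {G : SimpleGraph (Fin n)} {τ}
    (h : Lab G (c4 k) τ) (σ μ : ℝ) (hμ : 0 < μ) (hσ : σ ^ 2 = 1)
    (hm : (μ - σ) * (μ ^ 2 - k) = μ) :
    ∃ x : Fin n → ℝ, x ≠ 0 ∧ ∀ a, ∑ b, adjMat G a b * x b = μ * x a := by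
  set y : Fin 6 → ℝ := ![1 / μ, 1, μ - k / μ, σ * (μ - k / μ), σ, σ / μ] with hy
  refine ⟨fun a => y (τ a), ne_zero_of_label h y 1 (by simp [c4]) (by simp [hy]),
    h.vec μ y ?_⟩
  intro l
  fin_cases l <;> simp [Fin.sum_univ_succ, R01, hy, c4] <;> field_simp
  · ring
  · linear_combination - hm
  · linear_combination (-σ) * hm - (μ ^ 2 - k) * hσ
  · ring

lemma lab4_lower (k : ℕ) (hk : 8 ≤ k) {G : SimpleGraph (Fin (k + k + 4))} {τ}
    (h : Lab G (c4 k) τ) (ε : ℝ) (he0 : 0 < ε) (he1 : ε < 1) (hke : 1 ≤ ε ^ 2 * k) :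
    √(k + 1 - ε) ≤ lam 1 G ∧ √(k + 1 - ε) ≤ lam 2 G := by
  have hk' : (8 : ℝ) ≤ k := by exact_mod_cast hk
  set A := √((k : ℝ) + 1 - ε) with hA
  set B := √((k : ℝ) + 1) with hB
  set C := √((k : ℝ) + 2) with hC
  have A2 : A ^ 2 = k + 1 - ε := Real.sq_sqrt (by linarith)
  have B2 : B ^ 2 = k + 1 := Real.sq_sqrt (by linarith)
  have C2 : C ^ 2 = k + 2 := Real.sq_sqrt (by linarith)
  have A0 : 0 < A := Real.sqrt_pos.2 (by linarith)
  have AB : A < B := Real.sqrt_lt_sqrt (by linarith) (by linarith)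
  have BC : B < C := Real.sqrt_lt_sqrt (by linarith) (by linarith)
  have hCg : 2 ≤ C := by nlinarith
  have hAe : 1 ≤ ε * A := by
    have : 1 ≤ (ε * A) ^ 2 := by
      rw [mul_pow, A2]
      nlinarith [sq_nonneg ε]
    nlinarith [mul_pos he0 A0]
  obtain ⟨m2, hm2, hr2⟩ : ∃ m ∈ Set.Icc A B, (m + 1) * (m ^ 2 - k) - m = 0 := by
    have hc : ContinuousOn (fun m : ℝ => (m + 1) * (m ^ 2 - k) - m) (Set.Icc A B) := by fun_prop
    apply intermediate_value_Icc AB.le hc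
    constructor
    · simp only [A2]; nlinarith
    · simp only [B2]; nlinarith
  obtain ⟨m1, hm1, hr1⟩ : ∃ m ∈ Set.Icc B C, (m - 1) * (m ^ 2 - k) - m = 0 := by
    have hc : ContinuousOn (fun m : ℝ => (m - 1) * (m ^ 2 - k) - m) (Set.Icc B C) := by fun_prop
    apply intermediate_value_Icc BC.le hc
    constructor
    · simp only [B2]; nlinarith
    · simp only [C2]; nlinarith
  have hlt : m2 < m1 := by
    rcases (hm2.2.trans hm1.1).eq_or_lt with e | e
    · exfalso
      have e1 : m2 = B := le_antisymm hm2.2 (e ▸ hm1.1)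
      rw [e1, B2] at hr2
      linarith
    · exact e
  have p2 : 0 < m2 := A0.trans_le hm2.1
  obtain ⟨x, hx0, hx⟩ := lab4_eig k h 1 m1 (p2.trans hlt) (by norm_num) (by linarith)
  obtain ⟨y, hy0, hy⟩ := lab4_eig k h (-1) m2 p2 (by norm_num) (by linarith)
  have := lam_lower (by omega) G _ _ hlt x y hx0 hy0 hx hy
  exact ⟨(hm2.1.trans hlt.le).trans this.1, hm2.1.trans this.2⟩

lemma lab4_upper (k : ℕ) (hk : 8 ≤ k) {G : SimpleGraph (Fin (k + k + 4))} {τ}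
    (h : Lab G (c4 k) τ) (ε : ℝ) (he0 : 0 < ε) (he1 : ε < 1) (hke : 4 ≤ ε ^ 2 * k)
    (hl0 : 0 < lam 1 G) (hl : (k : ℝ) ≤ lam 1 G ^ 2) : lam 1 G ^ 2 ≤ k + 1 + ε := by
  by_contra hcon
  push Not at hcon
  obtain ⟨⟨x, hx0, hx⟩, -⟩ := lam_vec_ne (by omega) G
  obtain ⟨s, hs0, hs⟩ := h.quot _ hl0.ne' x hx0 hx
  set μ := lam 1 G with hμ
  have e0 := hs 0
  have e1 := hs 1
  have e2 := hs 2
  have e3 := hs 3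
  have e4 := hs 4
  have e5 := hs 5
  simp [Fin.sum_univ_succ, R01, c4] at e0 e1 e2 e3 e4 e5
  have hk' : (8 : ℝ) ≤ k := by exact_mod_cast hk
  have hAe : 2 ≤ ε * μ := by
    have : 4 ≤ (ε * μ) ^ 2 := by
      rw [mul_pow]
      nlinarith [sq_nonneg ε]
    nlinarith [mul_pos he0 hl0]
  have hm1 : 1 < μ := by nlinarith
  set t := μ ^ 2 - k with ht
  have t1 : 1 + ε < t := by linarith
  have q1 : t * s 1 = μ * s 2 := by rw [ht]; linear_combination e0 + μ * e1
  have q4 : t * s 4 = μ * s 3 := by rw [ht]; linear_combination e5 + μ * e4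
  have hp : s 2 + s 3 = 0 := by
    have : (t * (μ - 1) - μ) * (s 2 + s 3) = 0 := by
      linear_combination t * e2 + t * e3 + q1 + q4
    refine (mul_eq_zero.1 this).resolve_left (ne_of_gt ?_)
    nlinarith
  have hq : s 2 - s 3 = 0 := by
    have : (t * (μ + 1) - μ) * (s 2 - s 3) = 0 := by
      linear_combination t * e2 - t * e3 + q1 - q4
    refine (mul_eq_zero.1 this).resolve_left (ne_of_gt ?_)
    nlinarith
  have z2 : s 2 = 0 := by linarith
  have z3 : s 3 = 0 := by linarith
  have z1 : s 1 = 0 := by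
    rw [z2, mul_zero] at q1
    exact (mul_eq_zero.1 q1).resolve_left (by linarith)
  have z4 : s 4 = 0 := by
    rw [z3, mul_zero] at q4
    exact (mul_eq_zero.1 q4).resolve_left (by linarith)
  have z0 : s 0 = 0 := by rw [z1, z2] at e1; linarith
  have z5 : s 5 = 0 := by rw [z3, z4] at e4; linarith
  apply hs0
  funext l
  fin_cases l <;> simp [z0, z1, z2, z3, z4, z5]

lemma num1 (α x y X Y : ℝ) (ha0 : 0 < α) (ha1 : α ≤ 1 / 2) (hY : 0 < Y) (hXY : Y ≤ X)
    (hF : (max x 0) ^ 2 + (max y 0) ^ 2 ≤ X ^ 2 + Y ^ 2)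
    (hP : α * X + (1 - α) * Y ≤ α * x + (1 - α) * y) : Y ≤ y := by
  by_contra hy
  push Not at hy
  rcases le_or_gt x X with hx | hx
  · nlinarith [mul_le_mul_of_nonneg_left hx ha0.le,
      mul_lt_mul_of_pos_left hy (show 0 < 1 - α by linarith)]
  · rw [max_eq_left (by linarith)] at hF
    set y' := max y 0 with hy'
    have h1 : y ≤ y' := le_max_left _ _
    have h2 : 0 ≤ y' := le_max_right _ _
    have h3 : y' < Y := max_lt hy hY
    have h4 : x - X < Y - y' := by
      by_contra h5
      push Not at h5
      nlinarith [mul_le_mul_of_nonneg_right h5 (show 0 ≤ Y + y' by linarith),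
        mul_lt_mul_of_pos_left (show Y + y' < x + X by linarith) (show 0 < x - X by linarith)]
    have h6 : α * (x - X) ≤ (1 - α) * (x - X) :=
      mul_le_mul_of_nonneg_right (by linarith) (by linarith)
    have h7 : (1 - α) * (x - X) < (1 - α) * (Y - y') :=
      mul_lt_mul_of_pos_left h4 (by linarith)
    have h8 : (1 - α) * y ≤ (1 - α) * y' := mul_le_mul_of_nonneg_left h1 (by linarith)
    linarith

/-- Structure of near-maximizers. -/
lemma structure_max (k : ℕ) (hk : 8 ≤ k) (α : ℝ) (ha0 : 0 < α) (ha1 : α ≤ 1 / 2)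
    (G : SimpleGraph (Fin (k + k + 4))) (hG : G.IsTree)
    (hP : α * √(k + 1 + (1 + √5) / 2) + (1 - α) * √(k + 1 + (1 - √5) / 2) ≤
      α * lam 1 G + (1 - α) * lam 2 G) :
    √(k + 1 + (1 - √5) / 2) ≤ lam 2 G ∧ ((∃ τ, Lab G (c3 k) τ) ∨ (∃ τ, Lab G (c4 k) τ)) := by
  have s5 : √5 ^ 2 = (5 : ℝ) := Real.sq_sqrt (by norm_num)
  have s0 : (0 : ℝ) < √5 := Real.sqrt_pos.2 (by norm_num)
  have s3 : √5 < (9 / 4 : ℝ) := by nlinarith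
  have hk0 : (0 : ℝ) ≤ k := Nat.cast_nonneg _
  have hp1 : 0 < (k : ℝ) + 1 + (1 + √5) / 2 := by linarith
  have hp2 : 0 < (k : ℝ) + 1 + (1 - √5) / 2 := by linarith
  have hX2 := Real.sq_sqrt hp1.le
  have hY2 := Real.sq_sqrt hp2.le
  have hY0 := Real.sqrt_pos.2 hp2
  have hXY := Real.sqrt_le_sqrt (show (k : ℝ) + 1 + (1 - √5) / 2 ≤ k + 1 + (1 + √5) / 2 by linarith)
  have hY := num1 α _ _ _ _ ha0 ha1 hY0 hXY (by rw [hX2, hY2]; linarith [F1' k G hG]) hP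
  refine ⟨hY, ?_⟩
  have hl0 : 0 < lam 2 G := hY0.trans_le hY
  have hl : (k : ℝ) + 3 / 8 ≤ lam 2 G ^ 2 := by nlinarith
  obtain ⟨h1, h2, v, w, L1, L2, T⟩ := two_stars k hk G hG hl0 hl
  rcases T.hv with hv | hv <;> rcases T.hw with hw | hw
  · obtain ⟨τ, hτ⟩ := T.lab2 hv hw
    exact (lab2_false k hk G hG hl0 hl hτ).elim
  · exact Or.inl (T.symm.lab3 hw hv)
  · exact Or.inl (T.lab3 hv hw)
  · exact Or.inr (T.lab4 hv hw)

set_option maxHeartbeats 1000000 in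
lemma main_lt (k : ℕ) (hk : 8 ≤ k) (α δ : ℝ) (ha0 : 0 < α) (ha1 : α ≤ 1 / 2)
    (hδ : δ = -((1 - √5) / 2 + α * √5)) (hδ0 : 0 < δ) (hkd : 100 ≤ δ ^ 2 * k)
    (G : SimpleGraph (Fin (k + k + 4))) (hG : G.IsTree)
    (hmax : ∀ T : SimpleGraph (Fin (k + k + 4)), T.IsTree →
          α * lam 1 T + (1 - α) * lam 2 T ≤ α * lam 1 G + (1 - α) * lam 2 G) :
    ∃ τ, Lab G (c4 k) τ := by
  have s5 : √5 ^ 2 = (5 : ℝ) := Real.sq_sqrt (by norm_num)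
  have s0 : (0 : ℝ) < √5 := Real.sqrt_pos.2 (by norm_num)
  have s3 : √5 < (9 / 4 : ℝ) := by nlinarith
  have hk0 : (8 : ℝ) ≤ k := by exact_mod_cast hk
  have hp1 : 0 < (k : ℝ) + 1 + (1 + √5) / 2 := by linarith
  have hp2 : 0 < (k : ℝ) + 1 + (1 - √5) / 2 := by linarith
  have hX2 := Real.sq_sqrt hp1.le
  have hY2 := Real.sq_sqrt hp2.le
  have hY0 := Real.sqrt_pos.2 hp2
  have hX0 := Real.sqrt_pos.2 hp1
  obtain ⟨G3, hG3, τ3, hτ3⟩ := exists_dc3 k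
  have hl3 := lab3_lower k hτ3
  have hm3 := hmax G3 hG3
  have hst := structure_max k hk α ha0 ha1 G hG (by nlinarith [hl3.1, hl3.2])
  rcases hst.2 with ⟨τ, hτ⟩ | h
  swap
  · exact h
  exfalso
  have hl := lab3_lower k hτ
  have hF := F1' k G hG
  obtain ⟨τ4, hτ4⟩ := dc4_lab k
  have hδ1 : δ < 1 := by nlinarith [mul_pos ha0 s0]
  have hl4 := lab4_lower k hk hτ4 (δ / 2) (by linarith) (by linarith) (by nlinarith)
  have hm4 := hmax _ (dc4_tree k)
  set X := √((k : ℝ) + 1 + (1 + √5) / 2)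
  set Y := √((k : ℝ) + 1 + (1 - √5) / 2)
  set Z := √((k : ℝ) + 1 - δ / 2) with hZ
  have hZ0 : 0 ≤ Z := Real.sqrt_nonneg _
  have hZ2 : Z ^ 2 = k + 1 - δ / 2 := Real.sq_sqrt (by linarith)
  rw [max_eq_left (hX0.le.trans hl.1), max_eq_left (hY0.le.trans hl.2)] at hF
  have u1 : lam 1 G ≤ X := by nlinarith
  have u2 : lam 2 G ≤ Y := by nlinarith
  have hb : 0 ≤ 1 - α := by linarith
  have hZW : Z ≤ α * X + (1 - α) * Y := by
    have := mul_le_mul_of_nonneg_left hl4.1 ha0.le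
    have := mul_le_mul_of_nonneg_left hl4.2 hb
    have := mul_le_mul_of_nonneg_left u1 ha0.le
    have := mul_le_mul_of_nonneg_left u2 hb
    linarith
  have hW2 : (α * X + (1 - α) * Y) ^ 2 ≤ k + 1 - δ := by
    have : (α * X + (1 - α) * Y) ^ 2 = α * X ^ 2 + (1 - α) * Y ^ 2 - α * (1 - α) * (X - Y) ^ 2 := by
      ring
    rw [this, hX2, hY2, hδ]
    have : 0 ≤ α * (1 - α) * (X - Y) ^ 2 :=
      mul_nonneg (mul_nonneg ha0.le (by linarith)) (sq_nonneg _)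
    nlinarith
  have := pow_le_pow_left₀ hZ0 hZW 2
  linarith

set_option maxHeartbeats 1000000 in
lemma main_gt (k : ℕ) (hk : 8 ≤ k) (α δ : ℝ) (ha0 : 0 < α) (ha1 : α ≤ 1 / 2)
    (hδ : δ = ((1 - √5) / 2 + α * √5)) (hδ0 : 0 < δ) (hkd : 100 ≤ δ ^ 2 * k)
    (G : SimpleGraph (Fin (k + k + 4))) (hG : G.IsTree)
    (hmax : ∀ T : SimpleGraph (Fin (k + k + 4)), T.IsTree →
          α * lam 1 T + (1 - α) * lam 2 T ≤ α * lam 1 G + (1 - α) * lam 2 G) :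
    ∃ τ, Lab G (c3 k) τ := by
  have s5 : √5 ^ 2 = (5 : ℝ) := Real.sq_sqrt (by norm_num)
  have s0 : (0 : ℝ) < √5 := Real.sqrt_pos.2 (by norm_num)
  have s3 : √5 < (9 / 4 : ℝ) := by nlinarith
  have hk0 : (8 : ℝ) ≤ k := by exact_mod_cast hk
  have hp1 : 0 < (k : ℝ) + 1 + (1 + √5) / 2 := by linarith
  have hp2 : 0 < (k : ℝ) + 1 + (1 - √5) / 2 := by linarith
  have hX2 := Real.sq_sqrt hp1.le
  have hY2 := Real.sq_sqrt hp2.le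
  have hY0 := Real.sqrt_pos.2 hp2
  have hX0 := Real.sqrt_pos.2 hp1
  obtain ⟨G3, hG3, τ3, hτ3⟩ := exists_dc3 k
  have hl3 := lab3_lower k hτ3
  have hm3 := hmax G3 hG3
  have hWP : α * √(k + 1 + (1 + √5) / 2) + (1 - α) * √(k + 1 + (1 - √5) / 2) ≤
      α * lam 1 G + (1 - α) * lam 2 G := by nlinarith [hl3.1, hl3.2]
  have hst := structure_max k hk α ha0 ha1 G hG hWP
  rcases hst.2 with h | ⟨τ, hτ⟩
  · exact h
  exfalso
  have hanti := lam_anti (by omega) G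
  have hδ1 : δ < 1 := by nlinarith [mul_pos ha0 s0]
  have hl2 := hst.1
  set X := √((k : ℝ) + 1 + (1 + √5) / 2)
  set Y := √((k : ℝ) + 1 + (1 - √5) / 2)
  have hup := lab4_upper k hk hτ (δ / 2) (by linarith) (by linarith) (by nlinarith)
    (by linarith) (by nlinarith)
  have hW1 : α * X + (1 - α) * Y ≤ lam 1 G := by
    have := mul_le_mul_of_nonneg_left hanti (show 0 ≤ 1 - α by linarith)
    linarith
  have hW0 : 0 ≤ α * X + (1 - α) * Y := by
    have := mul_pos ha0 hX0
    have := mul_pos (show 0 < 1 - α by linarith) hY0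
    linarith
  have hW2 : (α * X + (1 - α) * Y) ^ 2 ≤ k + 1 + δ / 2 :=
    (pow_le_pow_left₀ hW0 hW1 2).trans hup
  have e : (α * X + (1 - α) * Y) ^ 2 = k + 1 + δ - α * (1 - α) * (X - Y) ^ 2 := by
    have : (α * X + (1 - α) * Y) ^ 2 = α * X ^ 2 + (1 - α) * Y ^ 2 - α * (1 - α) * (X - Y) ^ 2 := by
      ring
    rw [this, hX2, hY2, hδ]
    ring
  have hXY : (X - Y) ^ 2 * k ≤ 5 := by
    have h1 : ((X - Y) * (X + Y)) ^ 2 = 5 := by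
      have : (X - Y) * (X + Y) = √5 := by linear_combination hX2 - hY2
      rw [this, s5]
    have h2 : (k : ℝ) ≤ (X + Y) ^ 2 := by nlinarith [mul_pos hX0 hY0]
    calc (X - Y) ^ 2 * k ≤ (X - Y) ^ 2 * (X + Y) ^ 2 := by gcongr
      _ = 5 := by rw [← h1]; ring
  have hα : α * (1 - α) ≤ 1 / 4 := by nlinarith [sq_nonneg (α - 1 / 2)]
  have h3 : α * (1 - α) * (X - Y) ^ 2 ≤ 1 / 4 * (X - Y) ^ 2 :=
    mul_le_mul_of_nonneg_right hα (sq_nonneg _)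
  have h4 : δ / 2 ≤ 1 / 4 * (X - Y) ^ 2 := by linarith
  have h5 := mul_le_mul_of_nonneg_right h4 (show (0 : ℝ) ≤ k by linarith)
  have h6 : δ * k ≤ 5 / 2 := by linarith
  have h7 := mul_le_mul_of_nonneg_left h6 hδ0.le
  linarith

end PartF

theorem psi_max_even (α : ℝ) (hα0 : 0 < α) (hα1 : α ≤ 1 / 2)
    (hαne : α ≠ (Real.sqrt 5 - 1) / (2 * Real.sqrt 5)) :
    ∃ N : ℕ, ∀ n : ℕ, N ≤ n → Even n →
      ∀ Tstar : SimpleGraph (Fin n), Tstar.IsTree →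
        (∀ T : SimpleGraph (Fin n), T.IsTree →
          α * lam 1 T + (1 - α) * lam 2 T ≤
            α * lam 1 Tstar + (1 - α) * lam 2 Tstar) →
        ((α < (Real.sqrt 5 - 1) / (2 * Real.sqrt 5) →
            Nonempty (Tstar ≃g doubleComet ((n - 4) / 2) ((n - 4) / 2) 4)) ∧
         (α > (Real.sqrt 5 - 1) / (2 * Real.sqrt 5) →
            Nonempty (Tstar ≃g doubleComet ((n - 4) / 2) ((n - 2) / 2) 3))) := by
  have s0 : (0 : ℝ) < √5 := Real.sqrt_pos.2 (by norm_num)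
  set δ := (1 - √5) / 2 + α * √5 with hδ
  have key : δ = √5 * (α - (√5 - 1) / (2 * √5)) := by
    rw [hδ]; field_simp; ring
  have hδne : δ ≠ 0 := by
    rw [key]
    exact mul_ne_zero s0.ne' (sub_ne_zero.2 hαne)
  obtain ⟨K, hK⟩ := exists_nat_ge (100 / δ ^ 2)
  have hδ2 : 0 < δ ^ 2 := by positivity
  refine ⟨2 * (K + 8) + 4, ?_⟩
  intro n hn hev Tstar hT hmax
  obtain ⟨j, hj⟩ := hev
  obtain ⟨k, rfl⟩ : ∃ k, n = k + k + 4 := ⟨j - 2, by omega⟩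
  have e1 : (k + k + 4 - 4) / 2 = k := by omega
  have e2 : (k + k + 4 - 2) / 2 = k + 1 := by omega
  rw [e1, e2]
  have hk : 8 ≤ k := by omega
  have hkK : (K : ℝ) ≤ k := by exact_mod_cast (show K ≤ k by omega)
  have hkd : 100 ≤ δ ^ 2 * k := by
    rw [div_le_iff₀ hδ2] at hK
    nlinarith
  constructor
  · intro hlt
    have hneg : δ < 0 := by
      rw [key]
      exact mul_neg_of_pos_of_neg s0 (by linarith)
    obtain ⟨τ, hτ⟩ := main_lt k hk α (-δ) hα0 hα1 (by rw [hδ]) (by linarith)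
      (by rw [neg_sq]; exact hkd) Tstar hT hmax
    obtain ⟨τ', hτ'⟩ := dc4_lab k
    exact hτ.iso hτ'
  · intro hgt
    have hpos : 0 < δ := by
      rw [key]
      exact mul_pos s0 (by linarith)
    obtain ⟨τ, hτ⟩ := main_gt k hk α δ hα0 hα1 hδ hpos hkd Tstar hT hmax
    obtain ⟨τ', hτ'⟩ := dc3_lab k
    exact hτ.iso hτ'
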